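/- Let d ≥ 2 be an integer. Then the following are equivalent: (i) Littlewood's conjecture holds in d dimensions, i.e. for every α ∈ ℝ^d one has liminf_{n→∞} n·‖nα₁‖⋯‖nα_d‖ = 0; (ii) every d-dimensional Kronecker sequence has unbounded C³-smooth discrepancy, i.e. for every α ∈ ℝ^d and every ω ∈ 𝒢_{d+1,3}, and for every C > 0, there exist an integer N ≥ 1 and a test box 𝔅 = (γ;ρ) with |D_ω(𝔅;N)| > C. -/

import Mathlib

open scoped BigOperators

/-- The Fourier transform `∫ w(x) e^{-2πiξx} dx` of a real weight function. -/
noncomputable def fhat (w : ℝ → ℝ) (ξ : ℝ) : ℂ :=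
  ∫ x : ℝ, (w x : ℂ) * Complex.exp (-(2 * Real.pi * Complex.I * ξ * x))

/-- The class 𝒢_{k,ℓ} of good weight tuples. -/
def GoodWeights (k ℓ : ℕ) (w : Fin k → ℝ → ℝ) : Prop :=
  ∀ i : Fin k,
    (∀ x, 0 ≤ w i x) ∧
    (Function.support (w i) ⊆ Set.Icc (-2 : ℝ) 2) ∧
    ContDiff ℝ ℓ (w i) ∧
    (∀ ξ : ℝ, (fhat (w i) ξ).im = 0 ∧ 0 ≤ (fhat (w i) ξ).re) ∧
    0 < (fhat (w i) 0).re

/-- Multiplicative height `H(m) = ∏ max(1,|mᵢ|)`. -/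
noncomputable def Hmul {d : ℕ} (m : Fin d → ℝ) : ℝ := ∏ i, max 1 |m i|

/-- Distance from `x` to the nearest integer. -/
noncomputable def distInt (x : ℝ) : ℝ := |x - (round x : ℝ)|

/-- The constant 𝔠(ω) = ω̂₁(0)⋯ω̂_k(0). -/
noncomputable def smoothC {k : ℕ} (w : Fin k → ℝ → ℝ) : ℝ := ∏ i, (fhat (w i) 0).re

/-- Smooth discrepancy of the Kronecker sequence of α in the box (γ; ρ) at scale N. -/
noncomputable def Dbox (d : ℕ) (w : Fin (d+1) → ℝ → ℝ) (α γ ρ : Fin d → ℝ) (N : ℝ) : ℝ :=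
  (∑' p : (Fin d → ℤ) × ℤ,
      w (Fin.last d) ((p.2 : ℝ) / N) *
        ∏ i : Fin d, w i.castSucc (((p.1 i : ℝ) + (p.2 : ℝ) * α i - γ i) / ρ i))
    - smoothC w * ((∏ i, ρ i) * N)

/-- The point of the lattice `A ℤ^k` indexed by the integer vector `a`. -/
noncomputable def latPt {k : ℕ} (A : Matrix (Fin k) (Fin k) ℝ) (a : Fin k → ℤ) : Fin k → ℝ :=
  A.mulVec (fun i => (a i : ℝ))

/-- The point of the dual lattice `(A⁻¹)ᵀ ℤ^k` indexed by the integer vector `a`. -/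
noncomputable def dualPt {k : ℕ} (A : Matrix (Fin k) (Fin k) ℝ) (a : Fin k → ℤ) : Fin k → ℝ :=
  (A⁻¹).transpose.mulVec (fun i => (a i : ℝ))

/-- Smooth lattice discrepancy of the lattice `A ℤ^{d+1}` in the box (γ; ρ) at scale N. -/
noncomputable def DboxLat (d : ℕ) (A : Matrix (Fin (d+1)) (Fin (d+1)) ℝ)
    (w : Fin (d+1) → ℝ → ℝ) (γ ρ : Fin d → ℝ) (N : ℝ) : ℝ :=
  (∑' a : Fin (d+1) → ℤ,
      w (Fin.last d) (latPt A a (Fin.last d) / N) *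
        ∏ i : Fin d, w i.castSucc ((latPt A a i.castSucc - γ i) / ρ i))
    - smoothC w * ((∏ i, ρ i) * N)

/-- Side-length vector of a test box: each ρᵢ ∈ (0, 1/2). -/
def IsBox {d : ℕ} (ρ : Fin d → ℝ) : Prop := ∀ i, 0 < ρ i ∧ ρ i < 1/2

/-- Every nonzero dual lattice point (λ, λ_k) satisfies H(λ)·|λ_k| > 1/φ(H(λ)). -/
def DualBad (d : ℕ) (A : Matrix (Fin (d+1)) (Fin (d+1)) ℝ) (φ : ℝ → ℝ) : Prop :=
  ∀ a : Fin (d+1) → ℤ, dualPt A a ≠ 0 →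
    Hmul (fun i : Fin d => dualPt A a i.castSucc) * |dualPt A a (Fin.last d)| >
      1 / φ (Hmul (fun i : Fin d => dualPt A a i.castSucc))

section Part1
open scoped BigOperators

lemma distInt_nonneg (x : ℝ) : 0 ≤ distInt x := abs_nonneg _

lemma distInt_le (x : ℝ) (k : ℤ) : distInt x ≤ |x - k| := round_le x k

lemma distInt_le_half (x : ℝ) : distInt x ≤ 1 / 2 := abs_sub_round x

lemma distInt_nat_mul (k : ℕ) (x : ℝ) : distInt (k * x) ≤ k * distInt x := by
  have h := distInt_le (k * x) (k * round x)
  refine h.trans (le_of_eq ?_)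
  push_cast
  rw [← mul_sub, abs_mul, Nat.abs_cast]
  rfl

/-- Simultaneous Dirichlet theorem with different precisions. -/
lemma dirichlet_multi {d : ℕ} (α : Fin d → ℝ) (M : Fin d → ℕ) (hM : ∀ i, 0 < M i) :
    ∃ q : ℕ, 1 ≤ q ∧ q ≤ ∏ i, M i ∧ ∃ a : Fin d → ℤ, ∀ i, |(q : ℝ) * α i - a i| < 1 / M i := by
  have hcard : (Fintype.piFinset (fun i => Finset.range (M i))).card
      < (Finset.range (∏ i, M i + 1)).card := by
    simp [Fintype.card_piFinset]
  obtain ⟨x, hx, y, hy, hxy, h⟩ := Finset.exists_ne_map_eq_of_card_lt_of_maps_to hcard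
    (f := fun q i => ⌊Int.fract ((q : ℝ) * α i) * M i⌋₊) (by
      intro q _
      simp only [Finset.mem_coe, Fintype.mem_piFinset, Finset.mem_range]
      intro i
      have h0 : (0 : ℝ) < M i := by exact_mod_cast hM i
      rw [Nat.floor_lt (mul_nonneg (Int.fract_nonneg _) h0.le)]
      have := Int.fract_lt_one ((q : ℝ) * α i)
      nlinarith)
  wlog hlt : x < y generalizing x y
  · exact this y hy x hx hxy.symm h.symm (by omega)
  refine ⟨y - x, by omega, ?_, fun i => ⌊(y : ℝ) * α i⌋ - ⌊(x : ℝ) * α i⌋, fun i => ?_⟩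
  · simp only [Finset.mem_range] at hy
    omega
  · have h0 : (0 : ℝ) < M i := by exact_mod_cast hM i
    have hi : ⌊Int.fract ((x : ℝ) * α i) * M i⌋₊ = ⌊Int.fract ((y : ℝ) * α i) * M i⌋₊ :=
      congrFun h i
    have e : ((y - x : ℕ) : ℝ) * α i - ((⌊(y : ℝ) * α i⌋ - ⌊(x : ℝ) * α i⌋ : ℤ) : ℝ)
        = Int.fract ((y : ℝ) * α i) - Int.fract ((x : ℝ) * α i) := by
      rw [Nat.cast_sub hlt.le]
      push_cast
      unfold Int.fract
      ring
    rw [e, lt_div_iff₀ h0, ← abs_of_pos h0, ← abs_mul, sub_mul]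
    have a1 := Nat.floor_le (mul_nonneg (Int.fract_nonneg ((x : ℝ) * α i)) h0.le)
    have a2 := Nat.lt_floor_add_one (Int.fract ((x : ℝ) * α i) * M i)
    have a3 := Nat.floor_le (mul_nonneg (Int.fract_nonneg ((y : ℝ) * α i)) h0.le)
    have a4 := Nat.lt_floor_add_one (Int.fract ((y : ℝ) * α i) * M i)
    rw [← hi] at a3 a4
    rw [abs_lt]
    constructor <;> linarith

lemma frequently_small (x : ℝ) (M : ℕ) : ∃ n : ℕ, M ≤ n ∧ (n : ℝ) * distInt (n * x) ≤ 1 := by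
  by_cases h0 : ∃ n : ℕ, 0 < n ∧ distInt (n * x) = 0
  · obtain ⟨n, hn, h⟩ := h0
    refine ⟨M * n, Nat.le_mul_of_pos_right _ hn, ?_⟩
    have := distInt_nat_mul M (n * x)
    rw [h, mul_zero, ← mul_assoc] at this
    have h2 := distInt_nonneg (M * n * x)
    have : distInt (M * n * x) = 0 := le_antisymm this h2
    push_cast
    rw [this]; norm_num
  · push Not at h0
    have hpos : ∀ n : ℕ, 0 < n → 0 < distInt (n * x) :=
      fun n hn => lt_of_le_of_ne (distInt_nonneg _) (Ne.symm (h0 n hn))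
    obtain ⟨μ, hμ, hle⟩ : ∃ μ : ℝ, 0 < μ ∧ ∀ n ∈ Finset.Icc 1 M, μ ≤ distInt (n * x) := by
      clear h0
      induction M with
      | zero => exact ⟨1, one_pos, by simp⟩
      | succ k ih =>
        obtain ⟨μ, hμ, h⟩ := ih
        refine ⟨min μ (distInt ((k + 1 : ℕ) * x)), lt_min hμ (hpos _ (by omega)), ?_⟩
        intro n hn
        simp only [Finset.mem_Icc] at hn
        rcases Nat.lt_or_ge k n with h1 | h1
        · obtain rfl : n = k + 1 := by omega
          exact min_le_right _ _
        · exact (min_le_left _ _).trans (h n (by simp; omega))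
    obtain ⟨N, hN⟩ := exists_nat_gt (1 / μ)
    have hN0 : (0 : ℝ) < N := lt_trans (by positivity) hN
    have hN0' : 0 < N := by exact_mod_cast hN0
    obtain ⟨k, hk, hkN, hd⟩ := Real.exists_nat_abs_mul_sub_round_le x hN0'
    have hd' : distInt (k * x) ≤ 1 / (N + 1) := hd
    refine ⟨k, ?_, ?_⟩
    · by_contra hlt
      have := hle k (by simp; omega)
      have h3 : 1 / ((N : ℝ) + 1) < μ := by
        rw [div_lt_iff₀ (by positivity)]
        rw [div_lt_iff₀ hμ] at hN
        nlinarith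
      linarith
    · have : (k : ℝ) ≤ N := by exact_mod_cast hkN
      calc (k : ℝ) * distInt (k * x) ≤ N * (1 / (N + 1)) := by
            gcongr
            exact distInt_nonneg _
        _ ≤ 1 := by
            rw [mul_one_div, div_le_one (by positivity)]; linarith

/-- The Littlewood product. -/
noncomputable def lwu {d : ℕ} (α : Fin d → ℝ) (n : ℕ) : ℝ :=
  (n : ℝ) * ∏ i, distInt ((n : ℝ) * α i)

lemma lwu_nonneg {d : ℕ} (α : Fin d → ℝ) (n : ℕ) : 0 ≤ lwu α n :=
  mul_nonneg (Nat.cast_nonneg _) (Finset.prod_nonneg fun _ _ => distInt_nonneg _)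

lemma lwu_mul {d : ℕ} (α : Fin d → ℝ) (k n : ℕ) : lwu α (k * n) ≤ (k : ℝ) ^ (d + 1) * lwu α n := by
  unfold lwu
  have : ∏ i, distInt (((k * n : ℕ) : ℝ) * α i) ≤ ∏ i, ((k : ℝ) * distInt (n * α i)) := by
    apply Finset.prod_le_prod
    · intros; exact distInt_nonneg _
    · intro i _
      have := distInt_nat_mul k (n * α i)
      push_cast
      rwa [mul_assoc]
  rw [Finset.prod_mul_distrib] at this
  simp only [Finset.prod_const, Finset.card_univ, Fintype.card_fin] at this
  calc ((k * n : ℕ) : ℝ) * ∏ i, distInt (((k * n : ℕ) : ℝ) * α i)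
      ≤ ((k * n : ℕ) : ℝ) * ((k : ℝ) ^ d * ∏ i, distInt (n * α i)) := by gcongr
    _ = _ := by push_cast; ring

lemma lwu_frequently {d : ℕ} (hd : 2 ≤ d) (α : Fin d → ℝ) :
    ∃ᶠ n in Filter.atTop, lwu α n ≤ 1 := by
  rw [Filter.frequently_atTop]
  intro M
  let i0 : Fin d := ⟨0, by omega⟩
  obtain ⟨n, hn, h⟩ := frequently_small (α i0) M
  refine ⟨n, hn, le_trans ?_ h⟩
  unfold lwu
  gcongr
  rw [← Finset.mul_prod_erase _ _ (Finset.mem_univ i0)]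
  apply mul_le_of_le_one_right (distInt_nonneg _)
  apply Finset.prod_le_one
  · intros; exact distInt_nonneg _
  · intros; exact (distInt_le_half _).trans (by norm_num)

lemma liminf_lwu_iff {d : ℕ} (hd : 2 ≤ d) (α : Fin d → ℝ) :
    Filter.liminf (lwu α) Filter.atTop = 0 ↔ ∀ ε > 0, ∃ n : ℕ, 1 ≤ n ∧ lwu α n < ε := by
  have hco : Filter.IsCoboundedUnder (· ≥ ·) Filter.atTop (lwu α) :=
    Filter.IsCoboundedUnder.of_frequently_le (lwu_frequently hd α)
  have hbd : Filter.IsBoundedUnder (· ≥ ·) Filter.atTop (lwu α) :=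
    Filter.isBoundedUnder_of ⟨0, fun n => lwu_nonneg α n⟩
  constructor
  · intro h ε hε
    have := (Filter.frequently_lt_of_liminf_lt hco (by rw [h]; exact hε))
    rw [Filter.frequently_atTop] at this
    obtain ⟨n, hn, h⟩ := this 1
    exact ⟨n, hn, h⟩
  · intro h
    have h0 : 0 ≤ Filter.liminf (lwu α) Filter.atTop :=
      Filter.le_liminf_of_le hco (Filter.Eventually.of_forall fun n => lwu_nonneg α n)
    by_contra hne
    have hpos : 0 < Filter.liminf (lwu α) Filter.atTop := lt_of_le_of_ne h0 (Ne.symm hne)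
    obtain ⟨c, hc, hcl⟩ := exists_between hpos
    have hev := Filter.eventually_lt_of_lt_liminf hcl hbd
    rw [Filter.eventually_atTop] at hev
    obtain ⟨M, hM⟩ := hev
    have hp : (0 : ℝ) < ((M + 1 : ℕ) : ℝ) ^ (d + 1) := by positivity
    obtain ⟨n, hn, hlt⟩ := h (c / ((M + 1 : ℕ) : ℝ) ^ (d + 1)) (by positivity)
    have h1 := hM ((M + 1) * n) (by nlinarith)
    have h2 := lwu_mul α (M + 1) n
    rw [lt_div_iff₀ hp] at hlt
    linarith

end Part1

section Part2
open scoped BigOperators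

lemma transference {d : ℕ} (hd : 2 ≤ d) (α : Fin d → ℝ) (c : ℝ) (hc : 0 < c)
    (h : ∀ n : ℕ, 1 ≤ n → c ≤ lwu α n) :
    ∃ ε : ℝ, 0 < ε ∧ ∀ m : Fin d → ℤ, m ≠ 0 →
      ε ≤ (∏ i, max 1 |(m i : ℝ)|) * distInt (∑ i, m i * α i) := by
  obtain ⟨R0, hR0⟩ := exists_nat_gt (2 * d / c)
  set R : ℕ := R0 + 2 with hRdef
  have hR2 : (2 : ℝ) ≤ R := by rw [hRdef]; push_cast; linarith [Nat.cast_nonneg (α := ℝ) R0]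
  have hRpos : (0 : ℝ) < R := by linarith
  have hd0 : (0 : ℝ) < d := by exact_mod_cast (by omega : 0 < d)
  have hRc : 2 * d / (R : ℝ) < c := by
    rw [div_lt_iff₀ hRpos]
    rw [div_lt_iff₀ hc] at hR0
    have : (R0 : ℝ) ≤ R := by rw [hRdef]; push_cast; linarith
    nlinarith
  have hK : (0 : ℝ) < (2 * d * R) ^ d := by positivity
  refine ⟨1 / ((2 * d * R) ^ d * (2 * R)), by positivity, fun m hm => ?_⟩
  by_contra hlt
  push Not at hlt
  obtain ⟨i0, hi0⟩ : ∃ i, m i ≠ 0 := by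
    by_contra hcon
    push Not at hcon
    exact hm (funext hcon)
  set θ := distInt (∑ i, m i * α i) with hθ
  have hθ0 : 0 ≤ θ := distInt_nonneg _
  set n0 : ℤ := round (∑ i, m i * α i) with hn0
  let hh : Fin d → ℕ := fun i => max 1 (m i).natAbs
  have hhpos : ∀ i, 0 < hh i := fun i => lt_of_lt_of_le one_pos (le_max_left _ _)
  have hhm : ∀ i, ((hh i : ℕ) : ℝ) = max 1 |(m i : ℝ)| := by
    intro i
    simp only [hh, Nat.cast_max, Nat.cast_one, Nat.cast_natAbs, Int.cast_abs]
  let M : Fin d → ℕ := fun i => 2 * d * (if i = i0 then 1 else R) * hh i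
  have hMpos : ∀ i, 0 < M i := by
    intro i
    have := hhpos i
    have hR' : 0 < R := by omega
    have hd' : 0 < d := by omega
    simp only [M]
    split_ifs <;> positivity
  have hMposR : ∀ i, (0 : ℝ) < M i := fun i => by exact_mod_cast hMpos i
  obtain ⟨q, hq1, hqM, a, ha⟩ := dirichlet_multi α M hMpos
  set P : ℝ := ∏ i, (M i : ℝ) with hP
  have hqP : (q : ℝ) ≤ P := by
    rw [hP]; exact_mod_cast hqM
  have hPle : P ≤ (2 * d * R) ^ d * ∏ i, max 1 |(m i : ℝ)| := by
    have : (2 * (d : ℝ) * R) ^ d = ∏ _i : Fin d, (2 * (d : ℝ) * R) := by simp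
    rw [hP, this, ← Finset.prod_mul_distrib]
    apply Finset.prod_le_prod
    · intros; positivity
    · intro i _
      rw [← hhm i]
      simp only [M]
      push_cast
      gcongr
      split_ifs
      · linarith
      · exact le_rfl
  have hqθ : (q : ℝ) * θ < 1 / (2 * R) := by
    calc (q : ℝ) * θ ≤ P * θ := by gcongr
      _ ≤ ((2 * d * R) ^ d * ∏ i, max 1 |(m i : ℝ)|) * θ := by gcongr
      _ = (2 * d * R) ^ d * ((∏ i, max 1 |(m i : ℝ)|) * θ) := by ring
      _ < (2 * d * R) ^ d * (1 / ((2 * d * R) ^ d * (2 * R))) := by gcongr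
      _ = 1 / (2 * R) := by field_simp
  -- integrality
  have hmx : ∀ i, |(m i : ℝ)| ≤ hh i := fun i => by rw [hhm i]; exact le_max_right _ _
  set x : Fin d → ℝ := fun i => (q : ℝ) * α i - a i with hx
  have hmi : ∀ i, |(m i : ℝ) * x i| ≤ 1 / (2 * d * (if i = i0 then (1 : ℝ) else R)) := by
    intro i
    have hhp : (0 : ℝ) < hh i := by exact_mod_cast hhpos i
    have hs : (0 : ℝ) < (if i = i0 then (1 : ℝ) else R) := by split_ifs <;> linarith
    rw [abs_mul]
    calc |(m i : ℝ)| * |x i| ≤ hh i * (1 / M i) :=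
          mul_le_mul (hmx i) (ha i).le (abs_nonneg _) hhp.le
      _ = _ := by
          simp only [M]
          push_cast
          field_simp
  have hsum : ∑ i ∈ Finset.univ.erase i0, |(m i : ℝ) * x i| ≤ 1 / (2 * R) := by
    calc ∑ i ∈ Finset.univ.erase i0, |(m i : ℝ) * x i|
        ≤ ∑ i ∈ Finset.univ.erase i0, 1 / (2 * d * (R : ℝ)) := by
          apply Finset.sum_le_sum
          intro i hi
          have := hmi i
          rwa [if_neg (Finset.ne_of_mem_erase hi)] at this
      _ ≤ ∑ i : Fin d, 1 / (2 * d * (R : ℝ)) := by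
          apply Finset.sum_le_sum_of_subset_of_nonneg (Finset.erase_subset _ _)
          intros; positivity
      _ = 1 / (2 * R) := by
          simp only [Finset.sum_const, Finset.card_univ, Fintype.card_fin, nsmul_eq_mul]
          field_simp
  have hi0b : |(m i0 : ℝ) * x i0| ≤ 1 / 4 := by
    have := hmi i0
    rw [if_pos rfl] at this
    refine this.trans ?_
    have : (2 : ℝ) ≤ d := by exact_mod_cast hd
    apply one_div_le_one_div_of_le <;> linarith
  have h2R : 1 / (2 * (R : ℝ)) ≤ 1 / 4 := by
    apply one_div_le_one_div_of_le <;> linarith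
  set s : ℝ := ∑ i ∈ Finset.univ.erase i0, (m i : ℝ) * x i with hs
  have hsle : |s| ≤ 1 / (2 * R) := (Finset.abs_sum_le_sum_abs _ _).trans hsum
  set e : ℝ := (q : ℝ) * ((∑ i, m i * α i) - n0) with he
  have heabs : |e| < 1 / (2 * R) := by
    rw [he, abs_mul, Nat.abs_cast]
    exact hqθ
  have hint : (m i0 : ℝ) * x i0 + s - e = ((q * n0 - ∑ i, m i * a i : ℤ) : ℝ) := by
    rw [hs, Finset.add_sum_erase Finset.univ (fun i => (m i : ℝ) * x i) (Finset.mem_univ i0), he]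
    push_cast
    simp only [hx, mul_sub, Finset.sum_sub_distrib, Finset.mul_sum]
    have : ∀ i, (m i : ℝ) * (q * α i) = q * (m i * α i) := fun i => by ring
    simp only [this]
    ring
  have hzero : (q * n0 - ∑ i, m i * a i : ℤ) = 0 := by
    rw [← Int.abs_lt_one_iff]
    have : |((q * n0 - ∑ i, m i * a i : ℤ) : ℝ)| < 1 := by
      rw [← hint]
      have h1 := abs_le.1 hi0b
      have h2 := abs_le.1 hsle
      have h3 := abs_lt.1 heabs
      rw [abs_lt]
      constructor <;> linarith
    exact_mod_cast this
  rw [hzero, Int.cast_zero] at hint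
  have hfin : |(m i0 : ℝ) * x i0| ≤ 1 / R := by
    have h2 := abs_le.1 hsle
    have h3 := abs_lt.1 heabs
    have : 1 / (R : ℝ) = 1 / (2 * R) + 1 / (2 * R) := by field_simp; norm_num
    rw [abs_le, this]
    constructor <;> linarith
  have hm0 : (0 : ℝ) < |(m i0 : ℝ)| := abs_pos.2 (by exact_mod_cast hi0)
  have hhm0 : ((hh i0 : ℕ) : ℝ) = |(m i0 : ℝ)| := by
    rw [hhm]
    apply max_eq_right
    exact_mod_cast Int.one_le_abs hi0
  have hMx : (M i0 : ℝ) * |x i0| ≤ 2 * d / R := by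
    have : (M i0 : ℝ) = 2 * d * |(m i0 : ℝ)| := by
      rw [← hhm0]; simp only [M]; push_cast; simp
    rw [this, mul_assoc, ← abs_mul]
    calc 2 * (d : ℝ) * |(m i0 : ℝ) * x i0| ≤ 2 * d * (1 / R) := by gcongr
      _ = _ := by ring
  have hprod : ∏ i, distInt ((q : ℝ) * α i) ≤
      |x i0| * ∏ i ∈ Finset.univ.erase i0, (1 / (M i : ℝ)) := by
    rw [← Finset.mul_prod_erase _ _ (Finset.mem_univ i0)]
    apply mul_le_mul (distInt_le _ _) _ (Finset.prod_nonneg fun _ _ => distInt_nonneg _)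
      (abs_nonneg _)
    apply Finset.prod_le_prod
    · intros; exact distInt_nonneg _
    · intro i _
      exact (distInt_le _ _).trans (ha i).le
  have hlast : lwu α q ≤ 2 * d / R := by
    unfold lwu
    calc (q : ℝ) * ∏ i, distInt ((q : ℝ) * α i)
        ≤ P * (|x i0| * ∏ i ∈ Finset.univ.erase i0, (1 / (M i : ℝ))) :=
          mul_le_mul hqP hprod (Finset.prod_nonneg fun _ _ => distInt_nonneg _) (by positivity)
      _ = (M i0 * |x i0|) * ∏ i ∈ Finset.univ.erase i0, ((M i : ℝ) * (1 / (M i : ℝ))) := by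
          rw [hP, ← Finset.mul_prod_erase _ _ (Finset.mem_univ i0), Finset.prod_mul_distrib]
          ring
      _ = M i0 * |x i0| := by
          rw [Finset.prod_eq_one, mul_one]
          intro i _
          exact mul_one_div_cancel (hMposR i).ne'
      _ ≤ _ := hMx
  linarith [h q hq1]

end Part2

section Part3
open scoped BigOperators

/-- The summand of the counting function. -/
noncomputable def boxTerm (d : ℕ) (w : Fin (d+1) → ℝ → ℝ) (α γ ρ : Fin d → ℝ) (N : ℝ)
    (p : (Fin d → ℤ) × ℤ) : ℝ :=
  w (Fin.last d) ((p.2 : ℝ) / N) *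
        ∏ i : Fin d, w i.castSucc (((p.1 i : ℝ) + (p.2 : ℝ) * α i - γ i) / ρ i)

lemma boxTerm_finite {d : ℕ} {w : Fin (d+1) → ℝ → ℝ} (hw : GoodWeights (d+1) 3 w)
    (α γ ρ : Fin d → ℝ) (hρ : ∀ i, 0 < ρ i) (N : ℝ) (hN : 0 < N) :
    (Function.support (boxTerm d w α γ ρ N)).Finite := by
  let B : Fin d → ℤ := fun i => ⌈2 * ρ i + |γ i| + 2 * N * |α i|⌉
  apply ((Set.finite_Icc (-B) B).prod (Set.finite_Icc (-⌈2 * N⌉) ⌈2 * N⌉)).subset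
  intro p hp
  simp only [Function.mem_support, boxTerm] at hp
  have h1 := left_ne_zero_of_mul hp
  have h2 := right_ne_zero_of_mul hp
  have h1' := (hw (Fin.last d)).2.1 (Function.mem_support.2 h1)
  have hn : |(p.2 : ℝ)| ≤ 2 * N := by
    rw [abs_le]
    rw [Set.mem_Icc, le_div_iff₀ hN, div_le_iff₀ hN] at h1'
    constructor <;> linarith [h1'.1, h1'.2]
  have hn2 := abs_le.1 hn
  have ha : ∀ i, |(p.1 i : ℝ)| ≤ 2 * ρ i + |γ i| + 2 * N * |α i| := by
    intro i
    have h3 := Finset.prod_ne_zero_iff.1 h2 i (Finset.mem_univ i)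
    have h4 := (hw i.castSucc).2.1 (Function.mem_support.2 h3)
    rw [Set.mem_Icc, le_div_iff₀ (hρ i), div_le_iff₀ (hρ i)] at h4
    have h5 : |(p.2 : ℝ) * α i| ≤ 2 * N * |α i| := by rw [abs_mul]; gcongr
    have h6 := abs_le.1 h5
    have h7 := neg_abs_le (γ i)
    have h8 := le_abs_self (γ i)
    rw [abs_le]
    constructor <;> linarith [h4.1, h4.2]
  refine ⟨⟨fun i => ?_, fun i => ?_⟩, ?_, ?_⟩
  · have := (abs_le.1 (ha i)).1
    have h9 := Int.le_ceil (2 * ρ i + |γ i| + 2 * N * |α i|)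
    have : -((B i : ℤ) : ℝ) ≤ p.1 i := by simp only [B]; linarith
    exact_mod_cast this
  · have := (abs_le.1 (ha i)).2
    have h9 := Int.le_ceil (2 * ρ i + |γ i| + 2 * N * |α i|)
    have : (p.1 i : ℝ) ≤ ((B i : ℤ) : ℝ) := by simp only [B]; linarith
    exact_mod_cast this
  · have h9 := Int.le_ceil (2 * N)
    have : -((⌈2 * N⌉ : ℤ) : ℝ) ≤ p.2 := by linarith
    exact_mod_cast this
  · have h9 := Int.le_ceil (2 * N)
    have : (p.2 : ℝ) ≤ ((⌈2 * N⌉ : ℤ) : ℝ) := by linarith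
    exact_mod_cast this

lemma good_bump {k : ℕ} {w : Fin k → ℝ → ℝ} (hw : GoodWeights k 3 w) :
    ∃ x : Fin k → ℝ, ∃ c δ : ℝ, 0 < c ∧ 0 < δ ∧ δ ≤ 1 ∧
      ∀ i y, |y - x i| ≤ δ → c ≤ w i y := by
  have h1 : ∀ i, ∃ x, 0 < w i x := by
    intro i
    by_contra hcon
    push Not at hcon
    have h0 : ∀ x, w i x = 0 := fun x => le_antisymm (hcon x) ((hw i).1 x)
    have := (hw i).2.2.2.2
    simp [fhat, h0] at this
  choose x hx using h1
  have hc : ∃ c : ℝ, 0 < c ∧ ∀ i, c < w i (x i) := by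
    have : ∀ᶠ c in nhdsWithin (0 : ℝ) (Set.Ioi 0), ∀ i, c < w i (x i) := by
      rw [Filter.eventually_all]
      intro i
      exact (eventually_lt_nhds (hx i)).filter_mono nhdsWithin_le_nhds
    obtain ⟨c, h, hc⟩ := (this.and self_mem_nhdsWithin).exists
    exact ⟨c, hc, h⟩
  obtain ⟨c, hc, hcw⟩ := hc
  have hδ : ∀ i, ∃ δ : ℝ, 0 < δ ∧ ∀ y, |y - x i| < δ → c ≤ w i y := by
    intro i
    have hcont : ContinuousAt (w i) (x i) := (hw i).2.2.1.continuous.continuousAt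
    have := hcont.eventually (lt_mem_nhds (hcw i))
    obtain ⟨δ, hδ, h⟩ := Metric.eventually_nhds_iff.1 this
    exact ⟨δ, hδ, fun y hy => (h (by rwa [Real.dist_eq])).le⟩
  choose δ hδ hδw using hδ
  have : ∀ᶠ t in nhdsWithin (0 : ℝ) (Set.Ioi 0), (∀ i, t < δ i) ∧ t < 1 := by
    rw [Filter.eventually_and, Filter.eventually_all]
    exact ⟨fun i => (eventually_lt_nhds (hδ i)).filter_mono nhdsWithin_le_nhds,
      (eventually_lt_nhds one_pos).filter_mono nhdsWithin_le_nhds⟩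
  obtain ⟨t, ⟨h, h'⟩, ht⟩ := (this.and self_mem_nhdsWithin).exists
  exact ⟨x, c, t, hc, ht, h'.le, fun i y hy => hδw i y (lt_of_le_of_lt hy (h i))⟩

lemma unbounded_of_littlewood {d : ℕ} (α : Fin d → ℝ)
    (hα : ∀ ε > 0, ∃ n : ℕ, 1 ≤ n ∧ lwu α n < ε)
    (w : Fin (d+1) → ℝ → ℝ) (hw : GoodWeights (d+1) 3 w) (C : ℝ) :
    ∃ N : ℕ, 1 ≤ N ∧ ∃ γ ρ : Fin d → ℝ, IsBox ρ ∧ C < |Dbox d w α γ ρ N| := by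
  obtain ⟨x, c, δ, hc, hδ, hδ1, hcw⟩ := good_bump hw
  obtain ⟨K0, hK0⟩ := exists_nat_gt ((C + 1) / c ^ (d + 1))
  set K : ℕ := K0 + 1 with hKdef
  have hK1 : (1 : ℝ) ≤ K := by
    rw [hKdef]; push_cast; linarith [Nat.cast_nonneg (α := ℝ) K0]
  have hKpos : (0 : ℝ) < K := by linarith
  have hKC : C + 1 < K * c ^ (d + 1) := by
    rw [div_lt_iff₀ (by positivity)] at hK0
    have : (K0 : ℝ) ≤ K := by rw [hKdef]; push_cast; linarith
    have h2 : 0 < c ^ (d + 1) := by positivity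
    nlinarith
  set η : ℝ := δ / (8 * K) with hη
  have hηpos : 0 < η := by positivity
  obtain ⟨R, hR⟩ := exists_nat_gt (1 / η)
  have hRpos : (0 : ℝ) < R := lt_trans (by positivity) hR
  have hRpos' : 0 < R := by exact_mod_cast hRpos
  have hRη : 1 / (R : ℝ) < η := by
    rw [div_lt_iff₀ hRpos]; rw [div_lt_iff₀ hηpos] at hR; linarith
  set Q : ℕ := R ^ d with hQ
  have hsm : 0 ≤ smoothC w := Finset.prod_nonneg fun i _ => ((hw i).2.2.2.1 0).2
  set A : ℝ := 3 * (K / δ) ^ (d + 1) * (smoothC w + 1) with hA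
  have hApos : 0 < A := by positivity
  have hQpos : (0 : ℝ) < (Q : ℝ) ^ (d + 1) := by rw [hQ]; push_cast; positivity
  obtain ⟨n, hn1, hn⟩ := hα (1 / (A * (Q : ℝ) ^ (d + 1))) (by positivity)
  obtain ⟨q, hq1, hqQ, a, ha⟩ := dirichlet_multi (fun i => (n : ℝ) * α i) (fun _ => R)
    (fun _ => hRpos')
  simp only [Finset.prod_const, Finset.card_univ, Fintype.card_fin] at hqQ
  set n' : ℕ := q * n with hn'
  have hn'1 : 1 ≤ n' := Nat.mul_pos hq1 hn1
  have hn'R : (1 : ℝ) ≤ n' := by exact_mod_cast hn'1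
  have hθη : ∀ i, distInt ((n' : ℝ) * α i) < η := by
    intro i
    refine lt_of_le_of_lt (distInt_le _ (a i)) (lt_trans ?_ hRη)
    have := ha i
    rw [hn']; push_cast; rwa [mul_assoc]
  have hlw : lwu α n' < 1 / A := by
    have h1 := lwu_mul α q n
    have h2 : (q : ℝ) ^ (d + 1) ≤ (Q : ℝ) ^ (d + 1) := by
      have : (q : ℝ) ≤ Q := by rw [hQ]; exact_mod_cast hqQ
      gcongr
    calc lwu α n' ≤ (q : ℝ) ^ (d + 1) * lwu α n := h1
      _ ≤ (Q : ℝ) ^ (d + 1) * lwu α n := by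
          gcongr
          exact lwu_nonneg _ _
      _ < (Q : ℝ) ^ (d + 1) * (1 / (A * (Q : ℝ) ^ (d + 1))) := by gcongr
      _ = 1 / A := by field_simp
  obtain ⟨τ, hτ, hτη, hτlt⟩ : ∃ τ : ℝ, 0 < τ ∧ τ < η ∧
      (n' : ℝ) * ∏ i, (distInt ((n' : ℝ) * α i) + τ) < 1 / A := by
    have hcont : Continuous fun τ : ℝ => (n' : ℝ) * ∏ i, (distInt ((n' : ℝ) * α i) + τ) := by
      fun_prop
    have h1 : ∀ᶠ τ in nhdsWithin (0 : ℝ) (Set.Ioi 0),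
        (n' : ℝ) * ∏ i, (distInt ((n' : ℝ) * α i) + τ) < 1 / A := by
      apply Filter.Eventually.filter_mono nhdsWithin_le_nhds
      apply hcont.continuousAt.eventually (gt_mem_nhds _)
      simpa [lwu] using hlw
    have h2 : ∀ᶠ τ in nhdsWithin (0 : ℝ) (Set.Ioi 0), τ < η :=
      (eventually_lt_nhds hηpos).filter_mono nhdsWithin_le_nhds
    obtain ⟨τ, ⟨h3, h4⟩, h5⟩ := ((h1.and h2).and self_mem_nhdsWithin).exists
    exact ⟨τ, h5, h4, h3⟩
  set ρ : Fin d → ℝ := fun i => K / δ * (distInt ((n' : ℝ) * α i) + τ) with hρ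
  have hρpos : ∀ i, 0 < ρ i := by
    intro i
    have := distInt_nonneg ((n' : ℝ) * α i)
    simp only [hρ]
    positivity
  have hbox : IsBox ρ := by
    intro i
    refine ⟨hρpos i, ?_⟩
    calc ρ i < K / δ * (η + η) := by
          simp only [hρ]
          have := hθη i
          gcongr
      _ = 1 / 4 := by rw [hη]; field_simp; norm_num
      _ < 1 / 2 := by norm_num
  set N : ℕ := ⌈2 * K * n' / δ⌉₊ with hN
  have hNge : 2 * K * n' / δ ≤ N := Nat.le_ceil _
  have hbig : 1 ≤ K * n' / δ := by
    rw [le_div_iff₀ hδ]; nlinarith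
  have hNle : (N : ℝ) ≤ 3 * (K * n' / δ) := by
    have := (Nat.ceil_lt_add_one (show (0 : ℝ) ≤ 2 * K * n' / δ by positivity)).le
    have e : 2 * K * n' / δ = 2 * (K * n' / δ) := by ring
    rw [← hN] at this
    linarith
  have hNpos : (0 : ℝ) < N := lt_of_lt_of_le (by positivity) hNge
  have hN1 : 1 ≤ N := by exact_mod_cast hNpos
  have hvol : smoothC w * ((∏ i, ρ i) * N) ≤ 1 := by
    have e : ∏ i, ρ i = (K / δ) ^ d * ∏ i, (distInt ((n' : ℝ) * α i) + τ) := by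
      simp only [hρ]
      rw [Finset.prod_mul_distrib]
      simp [div_pow]
    have hp0 : 0 ≤ ∏ i, (distInt ((n' : ℝ) * α i) + τ) :=
      Finset.prod_nonneg fun i _ => add_nonneg (distInt_nonneg _) hτ.le
    calc smoothC w * ((∏ i, ρ i) * N) ≤ (smoothC w + 1) * ((∏ i, ρ i) * (3 * (K * n' / δ))) := by
          have : 0 ≤ ∏ i, ρ i := Finset.prod_nonneg fun i _ => (hρpos i).le
          gcongr
          linarith
      _ = A * ((n' : ℝ) * ∏ i, (distInt ((n' : ℝ) * α i) + τ)) := by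
          rw [e, hA]; ring
      _ ≤ A * (1 / A) := by gcongr
      _ = 1 := by field_simp
  set b : ℤ := ⌊(N : ℝ) * x (Fin.last d)⌋ with hb
  set γ : Fin d → ℝ := fun i => b * α i - x i.castSucc * ρ i with hγ
  refine ⟨N, hN1, γ, ρ, hbox, ?_⟩
  have hsumm : Summable (boxTerm d w α γ ρ N) :=
    summable_of_hasFiniteSupport (boxTerm_finite hw α γ ρ hρpos N hNpos)
  have hnn : ∀ p, 0 ≤ boxTerm d w α γ ρ N p := fun p =>
    mul_nonneg ((hw _).1 _) (Finset.prod_nonneg fun i _ => (hw _).1 _)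
  let g : ℕ → (Fin d → ℤ) × ℤ := fun k => (fun i => -(k * round ((n' : ℝ) * α i)), b + k * n')
  have hg : Function.Injective g := by
    intro k l hkl
    have := congrArg Prod.snd hkl
    simp only [g, add_right_inj] at this
    have h2 : (n' : ℤ) ≠ 0 := by exact_mod_cast (by omega : n' ≠ 0)
    exact_mod_cast mul_right_cancel₀ h2 this
  have hterm : ∀ k ∈ Finset.range K, c ^ (d + 1) ≤ boxTerm d w α γ ρ N (g k) := by
    intro k hk
    have hkK : (k : ℝ) ≤ K := by exact_mod_cast (Finset.mem_range.1 hk).le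
    unfold boxTerm
    rw [pow_succ, mul_comm (c ^ d)]
    apply mul_le_mul
    · apply hcw
      simp only [g]
      push_cast
      have h1 := Int.floor_le ((N : ℝ) * x (Fin.last d))
      have h2 := Int.lt_floor_add_one ((N : ℝ) * x (Fin.last d))
      rw [← hb] at h1 h2
      have e : ((b : ℝ) + k * n') / N - x (Fin.last d)
          = ((b : ℝ) + k * n' - N * x (Fin.last d)) / N := by field_simp
      rw [e, abs_div, abs_of_pos hNpos, div_le_iff₀ hNpos]
      have h3 : 2 * K * n' ≤ δ * N := by
        rw [div_le_iff₀ hδ] at hNge; linarith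
      have h4 : (k : ℝ) * n' ≤ K * n' := by gcongr
      have h5 : (0 : ℝ) ≤ (k : ℝ) * n' := by positivity
      have h6 : 1 ≤ (K : ℝ) * n' := by nlinarith
      rw [abs_le]
      constructor <;> linarith
    · have : c ^ d = ∏ _i : Fin d, c := by simp
      rw [this]
      apply Finset.prod_le_prod
      · intros; exact hc.le
      · intro i _
        apply hcw
        simp only [g, hγ]
        push_cast
        have hp := hρpos i
        have e : (-((k : ℝ) * round ((n' : ℝ) * α i)) + ((b : ℝ) + k * n') * α i
            - (b * α i - x i.castSucc * ρ i)) / ρ i - x i.castSucc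
            = (k * ((n' : ℝ) * α i - round ((n' : ℝ) * α i))) / ρ i := by
          field_simp
          ring
        rw [e, abs_div, abs_of_pos hp, div_le_iff₀ hp, abs_mul, Nat.abs_cast]
        change (k : ℝ) * distInt ((n' : ℝ) * α i) ≤ δ * (K / δ * (distInt ((n' : ℝ) * α i) + τ))
        have h0 := distInt_nonneg ((n' : ℝ) * α i)
        calc (k : ℝ) * distInt ((n' : ℝ) * α i) ≤ K * (distInt ((n' : ℝ) * α i) + τ) := by
              gcongr
              linarith
          _ = _ := by field_simp
    · positivity
    · exact (hw _).1 _
  have hlow : K * c ^ (d + 1) ≤ ∑' p, boxTerm d w α γ ρ N p := by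
    calc K * c ^ (d + 1) = ∑ k ∈ Finset.range K, c ^ (d + 1) := by simp
      _ ≤ ∑ k ∈ Finset.range K, boxTerm d w α γ ρ N (g k) := Finset.sum_le_sum hterm
      _ = ∑ p ∈ (Finset.range K).map ⟨g, hg⟩, boxTerm d w α γ ρ N p := by
          rw [Finset.sum_map]; rfl
      _ ≤ _ := hsumm.sum_le_tsum _ (fun p _ => hnn p)
  have hD : Dbox d w α γ ρ N = (∑' p, boxTerm d w α γ ρ N p) - smoothC w * ((∏ i, ρ i) * N) := rfl
  refine lt_of_lt_of_le ?_ (le_abs_self _)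
  rw [hD]
  linarith

end Part3

section Part4
open scoped BigOperators ENNReal

lemma ennreal_tsum_pi_prod {ι : Type*} {n : ℕ} (f : Fin n → ι → ℝ≥0∞) :
    ∑' m : Fin n → ι, ∏ i, f i (m i) = ∏ i, ∑' a, f i a := by
  induction n with
  | zero => simp [tsum_fintype]
  | succ n ih =>
    rw [← (Fin.consEquiv (fun _ : Fin (n + 1) => ι)).tsum_eq, ENNReal.tsum_prod',
      Fin.prod_univ_succ, ← ih, ← ENNReal.tsum_mul_right]
    congr 1
    ext a
    rw [← ENNReal.tsum_mul_left]
    congr 1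
    ext m
    rw [Fin.prod_univ_succ]
    simp [Fin.consEquiv]

lemma complex_tsum_pi_prod {ι : Type*} {n : ℕ} (f : Fin n → ι → ℂ)
    (hf : ∀ i, Summable fun a => ‖f i a‖) :
    (Summable fun m : Fin n → ι => ‖∏ i, f i (m i)‖) ∧
    ∑' m : Fin n → ι, ∏ i, f i (m i) = ∏ i, ∑' a, f i a := by
  induction n with
  | zero => exact ⟨summable_of_hasFiniteSupport (Set.toFinite _), by simp [tsum_fintype]⟩
  | succ n ih =>
    obtain ⟨h1, h2⟩ := ih (fun i => f i.succ) (fun i => hf i.succ)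
    have e : ∀ p : ι × (Fin n → ι),
        ∏ i, f i ((Fin.consEquiv (fun _ : Fin (n + 1) => ι)) p i)
          = f 0 p.1 * ∏ i : Fin n, f i.succ (p.2 i) := by
      intro p
      rw [Fin.prod_univ_succ]
      simp [Fin.consEquiv]
    constructor
    · rw [← (Fin.consEquiv (fun _ : Fin (n + 1) => ι)).summable_iff]
      refine ((hf 0).mul_norm h1).congr ?_
      intro p
      simp only [Function.comp_apply]
      rw [e]
    · rw [← (Fin.consEquiv (fun _ : Fin (n + 1) => ι)).tsum_eq, Fin.prod_univ_succ, ← h2,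
        tsum_mul_tsum_of_summable_norm (hf 0) h1]
      exact tsum_congr e

/-- The decay weight. -/
noncomputable def Wt (t : ℝ) : ℝ := 1 / (1 + t) ^ 2

lemma Wt_nonneg (t : ℝ) : 0 ≤ Wt t := by unfold Wt; positivity

lemma Wt_le_one {t : ℝ} (ht : 0 ≤ t) : Wt t ≤ 1 := by
  unfold Wt
  rw [div_le_one (by positivity)]
  nlinarith

lemma Wt_anti {s t : ℝ} (hs : 0 ≤ s) (hst : s ≤ t) : Wt t ≤ Wt s := by
  unfold Wt
  gcongr

lemma sum_nat_Wt {s : ℝ} (hs : 0 < s) :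
    ∑' k : ℕ, ENNReal.ofReal (Wt (s * (k + 1))) ≤ ENNReal.ofReal (1 / s) := by
  apply ENNReal.tsum_le_of_sum_range_le
  intro n
  rw [← ENNReal.ofReal_sum_of_nonneg (fun _ _ => Wt_nonneg _)]
  apply ENNReal.ofReal_le_ofReal
  have key : ∀ k : ℕ, Wt (s * (k + 1)) ≤ (1 / s) * (1 / (1 + s * k))
      - (1 / s) * (1 / (1 + s * ((k + 1 : ℕ) : ℝ))) := by
    intro k
    unfold Wt
    have h1 : 0 < 1 + s * (k : ℝ) := by positivity
    have h2 : 0 < 1 + s * ((k : ℝ) + 1) := by positivity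
    have e : (1 / s) * (1 / (1 + s * k)) - (1 / s) * (1 / (1 + s * ((k + 1 : ℕ) : ℝ)))
        = 1 / ((1 + s * k) * (1 + s * (k + 1))) := by
      push_cast
      field_simp
      ring
    rw [e]
    apply one_div_le_one_div_of_le (by positivity)
    rw [sq]
    gcongr
    linarith
  calc ∑ k ∈ Finset.range n, Wt (s * (k + 1))
      ≤ ∑ k ∈ Finset.range n, ((1 / s) * (1 / (1 + s * k))
      - (1 / s) * (1 / (1 + s * ((k + 1 : ℕ) : ℝ)))) := Finset.sum_le_sum fun k _ => key k
    _ = 1 / s * (1 / (1 + s * ((0 : ℕ) : ℝ))) - (1 / s) * (1 / (1 + s * n)) :=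
        Finset.sum_range_sub' (fun k : ℕ => (1 / s) * (1 / (1 + s * (k : ℝ)))) n
    _ ≤ 1 / s := by
        have : 0 ≤ (1 / s) * (1 / (1 + s * (n : ℝ))) := by positivity
        simp only [Nat.cast_zero, mul_zero, add_zero, div_one, mul_one]
        linarith

lemma sum_int_Wt0 {s : ℝ} (hs : 0 < s) :
    ∑' k : ℤ, (if k = 0 then 0 else ENNReal.ofReal (Wt (s * |(k : ℝ)|)))
      ≤ ENNReal.ofReal (2 / s) := by
  set f : ℤ → ℝ≥0∞ := fun k => if k = 0 then 0 else ENNReal.ofReal (Wt (s * |(k : ℝ)|)) with hf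
  have h1 : ∑' n : ℕ, f n = ∑' k : ℕ, ENNReal.ofReal (Wt (s * (k + 1))) := by
    have h0 : ∑ i ∈ Finset.range 1, f (i : ℤ) = 0 := by simp [hf]
    rw [← ENNReal.summable.sum_add_tsum_nat_add' (k := 1), h0, zero_add]
    refine tsum_congr fun k => ?_
    simp only [hf]
    rw [if_neg (by positivity)]
    push_cast
    rw [abs_of_nonneg (by positivity)]
  have h2 : ∑' n : ℕ, f (-(n + 1 : ℤ)) = ∑' k : ℕ, ENNReal.ofReal (Wt (s * (k + 1))) := by
    refine tsum_congr fun k => ?_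
    simp only [hf]
    rw [if_neg (by omega)]
    push_cast
    rw [abs_neg, abs_of_nonneg (by positivity)]
  have h3 : HasSum f (∑' n : ℕ, f n + ∑' n : ℕ, f (-(n + 1 : ℤ))) :=
    HasSum.of_nat_of_neg_add_one ENNReal.summable.hasSum ENNReal.summable.hasSum
  rw [h3.tsum_eq, h1, h2]
  have := sum_nat_Wt hs
  calc _ ≤ ENNReal.ofReal (1 / s) + ENNReal.ofReal (1 / s) := add_le_add this this
    _ = _ := by
      rw [← ENNReal.ofReal_add (by positivity) (by positivity)]
      congr 1
      ring

lemma sum_int_Wt {s : ℝ} (hs : 0 < s) :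
    ∑' k : ℤ, ENNReal.ofReal (Wt (s * |(k : ℝ)|)) ≤ ENNReal.ofReal (1 + 2 / s) := by
  calc ∑' k : ℤ, ENNReal.ofReal (Wt (s * |(k : ℝ)|))
      ≤ ∑' k : ℤ, ((if k = 0 then 1 else 0) +
          (if k = 0 then 0 else ENNReal.ofReal (Wt (s * |(k : ℝ)|)))) := by
        apply ENNReal.tsum_le_tsum
        intro k
        split_ifs with h
        · simp [h, Wt]
        · simp
    _ ≤ 1 + ENNReal.ofReal (2 / s) := by
        rw [ENNReal.tsum_add, tsum_ite_eq]
        gcongr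
        exact sum_int_Wt0 hs
    _ = _ := by
        rw [ENNReal.ofReal_add (by positivity) (by positivity)]
        simp

/-- Separation estimate. -/
lemma count_box {d : ℕ} (α : Fin d → ℝ) (ε : ℝ) (hε : 0 < ε)
    (hα : ∀ m : Fin d → ℤ, m ≠ 0 →
      ε ≤ (∏ i, max 1 |(m i : ℝ)|) * distInt (∑ i, m i * α i))
    (T : Fin d → ℕ) (N : ℝ) (hN : 0 < N) :
    ∑' m : Fin d → ℤ, (if m ≠ 0 ∧ ∀ i, (m i).natAbs ≤ T i then
      ENNReal.ofReal (Wt (N * distInt (∑ i, m i * α i))) else 0)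
      ≤ ENNReal.ofReal (8 / (N * ε)) * ∏ i, ((2 * T i + 1 : ℕ) : ℝ≥0∞) := by
  set P : ℝ := ∏ i, ((2 * T i + 1 : ℕ) : ℝ) with hP
  have hPpos : 0 < P := Finset.prod_pos fun i _ => by positivity
  set δ : ℝ := ε / P with hδ
  have hδpos : 0 < δ := by positivity
  have hsep : ∀ m : Fin d → ℤ, m ≠ 0 → (∀ i, (m i).natAbs ≤ 2 * T i) →
      δ ≤ distInt (∑ i, m i * α i) := by
    intro m hm hT
    rw [hδ, div_le_iff₀ hPpos]
    refine (hα m hm).trans ?_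
    rw [mul_comm]
    apply mul_le_mul_of_nonneg_left _ (distInt_nonneg _)
    apply Finset.prod_le_prod
    · intros; positivity
    · intro i _
      have h1 : |(m i : ℝ)| = ((m i).natAbs : ℝ) := by
        rw [Nat.cast_natAbs, Int.cast_abs]
      rw [h1]
      have h2 : ((m i).natAbs : ℝ) ≤ (2 * T i : ℕ) := by exact_mod_cast hT i
      push_cast at h2 ⊢
      apply max_le
      · have : (0 : ℝ) ≤ T i := by positivity
        linarith
      · linarith
  let v : (Fin d → ℤ) → ℝ := fun m => (∑ i, m i * α i) - round (∑ i, m i * α i)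
  have hv : ∀ m, |v m| = distInt (∑ i, m i * α i) := fun m => rfl
  have hvsep : ∀ m m' : Fin d → ℤ, (∀ i, (m i).natAbs ≤ T i) → (∀ i, (m' i).natAbs ≤ T i) →
      m ≠ m' → δ ≤ |v m - v m'| := by
    intro m m' h h' hne
    have h1 := hsep (m - m') (sub_ne_zero.2 hne) (by
      intro i
      have := h i
      have := h' i
      simp only [Pi.sub_apply]
      omega)
    refine h1.trans ?_
    refine (distInt_le _ (round (∑ i, m i * α i) - round (∑ i, m' i * α i))).trans (le_of_eq ?_)
    congr 1
    simp only [v, Pi.sub_apply]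
    push_cast
    simp only [sub_mul, Finset.sum_sub_distrib]
    ring
  let S : Set (Fin d → ℤ) := {m | m ≠ 0 ∧ ∀ i, (m i).natAbs ≤ T i}
  let κ : S → ℤ := fun m => ⌊v m / (δ / 2)⌋
  have hκ : Function.Injective κ := by
    intro m m' hmm
    by_contra hne
    have hne' : (m : Fin d → ℤ) ≠ m' := fun h => hne (Subtype.ext h)
    have h1 := hvsep m m' m.2.2 m'.2.2 hne'
    have h2 := Int.abs_sub_lt_one_of_floor_eq_floor hmm
    rw [← sub_div, abs_div, abs_of_pos (by positivity : 0 < δ / 2), div_lt_iff₀ (by positivity)]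
      at h2
    linarith
  set f0 : ℤ → ℝ≥0∞ := fun k =>
    if k = 0 then 0 else ENNReal.ofReal (Wt ((N * δ / 4) * |(k : ℝ)|)) with hf0
  have hle : ∀ m : S, ENNReal.ofReal (Wt (N * distInt (∑ i, (m : Fin d → ℤ) i * α i)))
      ≤ f0 (κ m) := by
    intro m
    have h1 : δ ≤ |v m| := hsep m m.2.1 (fun i => (m.2.2 i).trans (by omega))
    have hfl := Int.floor_le (v m / (δ / 2))
    have hfl2 := Int.lt_floor_add_one (v m / (δ / 2))
    have hκm : κ m = ⌊v m / (δ / 2)⌋ := rfl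
    rw [← hκm, le_div_iff₀ (by positivity)] at hfl
    rw [← hκm, div_lt_iff₀ (by positivity)] at hfl2
    have hmain : κ m ≠ 0 ∧ δ / 4 * |(κ m : ℝ)| ≤ |v m| := by
      rcases le_abs'.1 h1 with hneg | hpos
      · have h3 : ((κ m : ℤ) : ℝ) ≤ -2 := by
          by_contra hc
          push Not at hc
          nlinarith
        refine ⟨?_, ?_⟩
        · intro h0
          rw [h0] at h3
          norm_num at h3
        · rw [abs_of_nonpos (by linarith), abs_of_nonpos (by linarith)]
          nlinarith
      · have h3 : (1 : ℝ) < (κ m : ℝ) := by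
          by_contra hc
          push Not at hc
          nlinarith
        refine ⟨?_, ?_⟩
        · intro h0
          rw [h0] at h3
          norm_num at h3
        · rw [abs_of_nonneg (by linarith), abs_of_nonneg (by linarith)]
          nlinarith
    simp only [hf0]
    rw [if_neg hmain.1]
    apply ENNReal.ofReal_le_ofReal
    apply Wt_anti (by positivity)
    rw [← hv]
    calc N * δ / 4 * |(κ m : ℝ)| = N * (δ / 4 * |(κ m : ℝ)|) := by ring
      _ ≤ N * |v m| := by gcongr; exact hmain.2
  have hsub : ∑' m : Fin d → ℤ, (if m ≠ 0 ∧ ∀ i, (m i).natAbs ≤ T i then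
      ENNReal.ofReal (Wt (N * distInt (∑ i, m i * α i))) else 0)
      = ∑' m : S, ENNReal.ofReal (Wt (N * distInt (∑ i, (m : Fin d → ℤ) i * α i))) := by
    rw [tsum_subtype S (fun m : Fin d → ℤ => ENNReal.ofReal (Wt (N * distInt (∑ i, m i * α i))))]
    refine tsum_congr fun m => ?_
    by_cases hm : m ≠ 0 ∧ ∀ i, (m i).natAbs ≤ T i
    · rw [if_pos hm, Set.indicator_of_mem (show m ∈ S from hm)]
    · rw [if_neg hm, Set.indicator_of_notMem (show m ∉ S from hm)]
  rw [hsub]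
  calc _ ≤ ∑' m : S, f0 (κ m) := ENNReal.tsum_le_tsum hle
    _ ≤ ∑' k, f0 k := ENNReal.tsum_comp_le_tsum_of_injective hκ f0
    _ ≤ ENNReal.ofReal (2 / (N * δ / 4)) := sum_int_Wt0 (by positivity)
    _ = ENNReal.ofReal (8 / (N * ε) * P) := by
        congr 1
        rw [hδ]
        field_simp
        norm_num
    _ = _ := by
        rw [ENNReal.ofReal_mul (by positivity), hP,
          ENNReal.ofReal_prod_of_nonneg (fun _ _ => by positivity)]
        simp only [ENNReal.ofReal_natCast]

/-- Abel weights. -/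
noncomputable def abelW (ρ : ℝ) (T : ℕ) : ℝ≥0∞ :=
  ENNReal.ofReal (Wt (ρ * T) - Wt (ρ * (T + 1 : ℕ)))

lemma abelW_tail {ρ : ℝ} (hρ : 0 < ρ) (n : ℕ) :
    ∑' T : ℕ, (if n ≤ T then abelW ρ T else 0) = ENNReal.ofReal (Wt (ρ * n)) := by
  rw [← ENNReal.summable.sum_add_tsum_nat_add' (k := n)]
  have h0 : ∑ i ∈ Finset.range n, (if n ≤ i then abelW ρ i else 0) = 0 := by
    apply Finset.sum_eq_zero
    intro i hi
    rw [if_neg (by simpa using hi)]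
  rw [h0, zero_add]
  have hnn : ∀ j : ℕ, 0 ≤ Wt (ρ * (j + n : ℕ)) - Wt (ρ * (j + 1 + n : ℕ)) := by
    intro j
    rw [sub_nonneg]
    apply Wt_anti (by positivity)
    gcongr
    omega
  have e : ∀ j : ℕ, (if n ≤ j + n then abelW ρ (j + n) else 0)
      = ENNReal.ofReal (Wt (ρ * (j + n : ℕ)) - Wt (ρ * (j + 1 + n : ℕ))) := by
    intro j
    rw [if_pos (by omega), abelW, add_right_comm j n 1]
  simp only [e]
  have hs : HasSum (fun j : ℕ => Wt (ρ * (j + n : ℕ)) - Wt (ρ * (j + 1 + n : ℕ)))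
      (Wt (ρ * n)) := by
    rw [hasSum_iff_tendsto_nat_of_nonneg hnn]
    have e2 : ∀ k : ℕ, ∑ j ∈ Finset.range k, (Wt (ρ * (j + n : ℕ)) - Wt (ρ * (j + 1 + n : ℕ)))
        = Wt (ρ * n) - Wt (ρ * (k + n : ℕ)) := by
      intro k
      have := Finset.sum_range_sub' (fun j : ℕ => Wt (ρ * (j + n : ℕ))) k
      simpa using this
    simp only [e2]
    have h3 : Filter.Tendsto (fun k : ℕ => Wt (ρ * (k + n : ℕ))) Filter.atTop (nhds 0) := by
      have h4 : Filter.Tendsto (fun k : ℕ => ρ * ((k + n : ℕ) : ℝ)) Filter.atTop Filter.atTop :=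
        Filter.Tendsto.const_mul_atTop hρ
          (tendsto_natCast_atTop_atTop.comp (Filter.tendsto_add_atTop_nat n))
      have h5 : Filter.Tendsto (fun t : ℝ => (1 + t) ^ 2) Filter.atTop Filter.atTop :=
        (Filter.tendsto_pow_atTop (by norm_num)).comp
          (Filter.tendsto_atTop_add_const_left _ _ Filter.tendsto_id)
      have h6 : Filter.Tendsto Wt Filter.atTop (nhds 0) := by
        unfold Wt
        simp only [one_div]
        exact h5.inv_tendsto_atTop
      exact h6.comp h4
    simpa using h3.const_sub (Wt (ρ * n))
  rw [← ENNReal.ofReal_tsum_of_nonneg hnn hs.summable, hs.tsum_eq]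

lemma abelW_mass {ρ : ℝ} (hρ : 0 < ρ) :
    ∑' T : ℕ, abelW ρ T * ((2 * T + 1 : ℕ) : ℝ≥0∞)
      = ∑' m : ℤ, ENNReal.ofReal (Wt (ρ * |(m : ℝ)|)) := by
  have e : ∀ m : ℤ, ENNReal.ofReal (Wt (ρ * |(m : ℝ)|))
      = ∑' T : ℕ, (if m.natAbs ≤ T then abelW ρ T else 0) := by
    intro m
    rw [abelW_tail hρ, Nat.cast_natAbs, Int.cast_abs]
  simp only [e]
  rw [ENNReal.tsum_comm]
  congr 1
  ext T
  have h2 : ∀ m : ℤ, (if m.natAbs ≤ T then abelW ρ T else 0)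
      = if m ∈ Finset.Icc (-(T : ℤ)) T then abelW ρ T else 0 := by
    intro m
    congr 1
    simp only [Finset.mem_Icc, eq_iff_iff]
    omega
  simp only [h2]
  rw [tsum_eq_sum (s := Finset.Icc (-(T : ℤ)) T) (by intro m hm; rw [if_neg hm])]
  rw [Finset.sum_ite_mem, Finset.inter_self, Finset.sum_const, Int.card_Icc, nsmul_eq_mul, mul_comm]
  congr 2
  omega

lemma main_sum {d : ℕ} (α : Fin d → ℝ) (ε : ℝ) (hε : 0 < ε)
    (hα : ∀ m : Fin d → ℤ, m ≠ 0 →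
      ε ≤ (∏ i, max 1 |(m i : ℝ)|) * distInt (∑ i, m i * α i))
    (ρ : Fin d → ℝ) (hρ : ∀ i, 0 < ρ i) (N : ℝ) (hN : 0 < N) :
    ∑' m : Fin d → ℤ, (if m ≠ 0 then
      (∏ i, ENNReal.ofReal (Wt (ρ i * |(m i : ℝ)|))) *
      ENNReal.ofReal (Wt (N * distInt (∑ i, m i * α i))) else 0)
      ≤ ENNReal.ofReal (8 / (N * ε)) * ∏ i, ENNReal.ofReal (1 + 2 / ρ i) := by
  set G : (Fin d → ℤ) → ℝ≥0∞ := fun m =>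
    ENNReal.ofReal (Wt (N * distInt (∑ i, m i * α i))) with hG
  have e : ∀ m : Fin d → ℤ, (if m ≠ 0 then
      (∏ i, ENNReal.ofReal (Wt (ρ i * |(m i : ℝ)|))) * G m else 0)
      = ∑' T : Fin d → ℕ, (∏ i, abelW (ρ i) (T i)) *
        (if m ≠ 0 ∧ ∀ i, (m i).natAbs ≤ T i then G m else 0) := by
    intro m
    by_cases hm : m = 0
    · simp [hm]
    · simp only [hm, ne_eq, not_false_eq_true, if_true, true_and]
      have : ∀ i, ENNReal.ofReal (Wt (ρ i * |(m i : ℝ)|))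
          = ∑' T : ℕ, (if (m i).natAbs ≤ T then abelW (ρ i) T else 0) := by
        intro i
        rw [abelW_tail (hρ i), Nat.cast_natAbs, Int.cast_abs]
      simp only [this]
      rw [← ennreal_tsum_pi_prod, ← ENNReal.tsum_mul_right]
      congr 1
      ext T
      by_cases hT : ∀ i, (m i).natAbs ≤ T i
      · simp [hT]
      · rw [if_neg hT, mul_zero]
        push Not at hT
        obtain ⟨i, hi⟩ := hT
        rw [Finset.prod_eq_zero (Finset.mem_univ i), zero_mul]
        rw [if_neg (by omega)]
  calc _ = ∑' m : Fin d → ℤ, ∑' T : Fin d → ℕ, (∏ i, abelW (ρ i) (T i)) *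
        (if m ≠ 0 ∧ ∀ i, (m i).natAbs ≤ T i then G m else 0) := tsum_congr e
    _ = ∑' T : Fin d → ℕ, (∏ i, abelW (ρ i) (T i)) *
        ∑' m : Fin d → ℤ, (if m ≠ 0 ∧ ∀ i, (m i).natAbs ≤ T i then G m else 0) := by
        rw [ENNReal.tsum_comm]
        simp only [ENNReal.tsum_mul_left]
    _ ≤ ∑' T : Fin d → ℕ, (∏ i, abelW (ρ i) (T i)) *
        (ENNReal.ofReal (8 / (N * ε)) * ∏ i, ((2 * T i + 1 : ℕ) : ℝ≥0∞)) := by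
        apply ENNReal.tsum_le_tsum
        intro T
        gcongr
        exact count_box α ε hε hα T N hN
    _ = ENNReal.ofReal (8 / (N * ε)) *
        ∑' T : Fin d → ℕ, ∏ i, (abelW (ρ i) (T i) * ((2 * T i + 1 : ℕ) : ℝ≥0∞)) := by
        rw [← ENNReal.tsum_mul_left]
        congr 1
        ext T
        rw [Finset.prod_mul_distrib]
        ring
    _ ≤ _ := by
        rw [ennreal_tsum_pi_prod (fun i (t : ℕ) => abelW (ρ i) t * ((2 * t + 1 : ℕ) : ℝ≥0∞))]
        gcongr with i
        rw [abelW_mass (hρ i)]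
        exact sum_int_Wt (hρ i)

end Part4

section Part5
open scoped BigOperators ENNReal FourierTransform ContDiff

lemma fhat_eq_fourier (w : ℝ → ℝ) (ξ : ℝ) : fhat w ξ = 𝓕 (fun x => (w x : ℂ)) ξ := by
  rw [Real.fourier_real_eq_integral_exp_smul]
  unfold fhat
  congr 1
  ext x
  rw [smul_eq_mul, mul_comm]
  congr 2
  push_cast
  ring

lemma fhat_im_of_even (w : ℝ → ℝ) (hw : ∀ x, w (-x) = w x) (ξ : ℝ) : (fhat w ξ).im = 0 := by
  rw [← Complex.conj_eq_iff_im]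
  unfold fhat
  rw [← integral_conj, ← MeasureTheory.integral_neg_eq_self]
  congr 1
  ext x
  rw [map_mul, Complex.conj_ofReal, ← Complex.exp_conj, hw]
  congr 2
  simp
  exact Or.inl (Or.inl (Complex.conj_ofNat 2))

lemma exists_weight : ∃ f : ℝ → ℝ, (∀ x, 0 ≤ f x) ∧ (Function.support f ⊆ Set.Icc (-2 : ℝ) 2) ∧
    ContDiff ℝ 3 f ∧ (∀ ξ : ℝ, (fhat f ξ).im = 0 ∧ 0 ≤ (fhat f ξ).re) ∧ 0 < (fhat f 0).re ∧
    ∃ B : ℝ, 0 < B ∧ ∀ ξ, ‖fhat f ξ‖ ≤ B * (1 / (1 + |ξ|) ^ 4) := by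
  let φ : ContDiffBump (0 : ℝ) := ⟨1 / 2, 1, by norm_num, by norm_num⟩
  let f : ℝ → ℝ := MeasureTheory.convolution φ φ (ContinuousLinearMap.mul ℝ ℝ)
    MeasureTheory.volume
  have hfx : ∀ x, f x = ∫ t, φ t * φ (x - t) := fun x => rfl
  have hint : MeasureTheory.Integrable (φ : ℝ → ℝ) :=
    φ.continuous.integrable_of_hasCompactSupport φ.hasCompactSupport
  have hconv : (fun x => (f x : ℂ)) = MeasureTheory.convolution (fun x => (φ x : ℂ))
      (fun x => (φ x : ℂ)) (ContinuousLinearMap.mul ℂ ℂ) MeasureTheory.volume := by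
    ext x
    rw [hfx, MeasureTheory.convolution_def, ← integral_complex_ofReal]
    simp
  have hfh : ∀ ξ, fhat f ξ = fhat φ ξ * fhat φ ξ := by
    intro ξ
    rw [fhat_eq_fourier, fhat_eq_fourier, hconv]
    exact Real.fourier_mul_convolution_eq hint.ofReal hint.ofReal ξ
  have him : ∀ ξ, (fhat φ ξ).im = 0 := fun ξ => fhat_im_of_even φ φ.neg ξ
  refine ⟨f, ?_, ?_, ?_, ?_, ?_, ?_⟩
  · intro x
    rw [hfx]
    exact MeasureTheory.integral_nonneg fun t => mul_nonneg φ.nonneg φ.nonneg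
  · refine (MeasureTheory.support_convolution_subset _).trans ?_
    rw [φ.support_eq, Real.ball_eq_Ioo]
    rintro _ ⟨a, ha, b, hb, rfl⟩
    simp only [φ, Set.mem_Ioo] at ha hb
    constructor <;> simp only <;> linarith [ha.1, ha.2, hb.1, hb.2]
  · exact φ.hasCompactSupport.contDiff_convolution_left _ φ.contDiff hint.locallyIntegrable
  · intro ξ
    rw [hfh, Complex.mul_im, Complex.mul_re, him]
    simp only [mul_zero, zero_mul, add_zero, sub_zero, true_and]
    exact mul_self_nonneg _
  · rw [hfh, Complex.mul_re, him]
    have h1 : fhat φ 0 = ((∫ x, φ x : ℝ) : ℂ) := by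
      unfold fhat
      rw [← integral_complex_ofReal]
      simp
    have h2 : 0 < ∫ x, φ x := φ.integral_pos
    rw [h1, Complex.ofReal_re]
    nlinarith
  · have hcs : HasCompactSupport (fun x => (φ x : ℂ)) :=
      φ.hasCompactSupport.comp_left (g := fun y : ℝ => (y : ℂ)) (by simp)
    have hcd : ContDiff ℝ ∞ (fun x => (φ x : ℂ)) :=
      Complex.ofRealCLM.contDiff.comp φ.contDiff
    let F := hcs.toSchwartzMap hcd
    have hF : ∀ ξ, (𝓕 F) ξ = fhat φ ξ := by
      intro ξ
      rw [fhat_eq_fourier]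
      rfl
    obtain ⟨C0, hC0, h0⟩ := (𝓕 F).decay 0 0
    obtain ⟨C2, hC2, h2⟩ := (𝓕 F).decay 2 0
    refine ⟨(2 * (C0 + C2)) ^ 2, by positivity, fun ξ => ?_⟩
    have h0' := h0 ξ
    have h2' := h2 ξ
    rw [norm_iteratedFDeriv_zero, hF] at h0' h2'
    rw [pow_zero, one_mul] at h0'
    rw [Real.norm_eq_abs] at h2'
    have hpos : 0 < 1 + |ξ| := by positivity
    have h3 : ‖fhat φ ξ‖ ≤ 2 * (C0 + C2) * (1 / (1 + |ξ|) ^ 2) := by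
      rw [mul_one_div, le_div_iff₀ (by positivity)]
      have h4 : (1 + |ξ|) ^ 2 ≤ 2 * (1 + |ξ| ^ 2) := by nlinarith [sq_nonneg (1 - |ξ|)]
      have h5 : 0 ≤ ‖fhat φ ξ‖ := norm_nonneg _
      nlinarith
    rw [hfh, norm_mul]
    calc ‖fhat φ ξ‖ * ‖fhat φ ξ‖ ≤ (2 * (C0 + C2) * (1 / (1 + |ξ|) ^ 2)) *
          (2 * (C0 + C2) * (1 / (1 + |ξ|) ^ 2)) := by gcongr
      _ = _ := by field_simp

lemma summable_of_ofReal {ι : Type*} {g : ι → ℝ} {K : ℝ} (hg : ∀ i, 0 ≤ g i) (hK : 0 ≤ K)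
    (h : ∑' i, ENNReal.ofReal (g i) ≤ ENNReal.ofReal K) : Summable g ∧ ∑' i, g i ≤ K := by
  have hs : ∀ s : Finset ι, ∑ i ∈ s, g i ≤ K := by
    intro s
    rw [← ENNReal.ofReal_le_ofReal_iff hK, ENNReal.ofReal_sum_of_nonneg (fun i _ => hg i)]
    exact (ENNReal.sum_le_tsum s).trans h
  have := summable_of_sum_le hg hs
  exact ⟨this, this.tsum_le_of_sum_le hs⟩

lemma decay_sum {N : ℝ} (hN : 0 < N) (θ : ℝ) :
    (Summable fun k : ℤ => 1 / (1 + |N * (k - θ)|) ^ 4) ∧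
    ∑' k : ℤ, 1 / (1 + |N * (k - θ)|) ^ 4 ≤ Wt (N * distInt θ) * (1 + 4 / N) := by
  apply summable_of_ofReal
  · intro k; positivity
  · exact mul_nonneg (Wt_nonneg _) (by positivity)
  rw [← (Equiv.addRight (round θ)).tsum_eq]
  have key : ∀ k : ℤ, ENNReal.ofReal (1 / (1 + |N * (((Equiv.addRight (round θ)) k : ℤ) - θ)|) ^ 4)
      ≤ ENNReal.ofReal (Wt (N * distInt θ)) * ENNReal.ofReal (Wt (N / 2 * |(k : ℝ)|)) := by
    intro k
    rw [← ENNReal.ofReal_mul (Wt_nonneg _)]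
    apply ENNReal.ofReal_le_ofReal
    simp only [Equiv.coe_addRight]
    push_cast
    set t : ℝ := θ - round θ with ht
    have htd : distInt θ = |t| := rfl
    have ht2 : |t| ≤ 1 / 2 := abs_sub_round θ
    have e : (k : ℝ) + round θ - θ = k - t := by rw [ht]; ring
    have hk : |t| ≤ |(k : ℝ) - t| ∧ |(k : ℝ)| / 2 ≤ |(k : ℝ) - t| := by
      by_cases hk0 : k = 0
      · simp [hk0]
      · have h1 : (1 : ℝ) ≤ |(k : ℝ)| := by exact_mod_cast Int.one_le_abs hk0
        have h2 := abs_sub_abs_le_abs_sub (k : ℝ) t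
        constructor <;> linarith
    rw [e, htd, abs_mul, abs_of_pos hN]
    unfold Wt
    rw [div_mul_div_comm, one_mul]
    apply one_div_le_one_div_of_le (by positivity)
    have h1 : N * |t| ≤ N * |(k : ℝ) - t| := mul_le_mul_of_nonneg_left hk.1 hN.le
    have h2 : N / 2 * |(k : ℝ)| ≤ N * |(k : ℝ) - t| := by
      have := hk.2
      nlinarith
    have e4 : (1 + N * |(k : ℝ) - t|) ^ 4
        = (1 + N * |(k : ℝ) - t|) ^ 2 * (1 + N * |(k : ℝ) - t|) ^ 2 := by ring
    rw [e4]
    gcongr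
  calc _ ≤ ∑' k : ℤ, ENNReal.ofReal (Wt (N * distInt θ)) *
        ENNReal.ofReal (Wt (N / 2 * |(k : ℝ)|)) := ENNReal.tsum_le_tsum key
    _ ≤ ENNReal.ofReal (Wt (N * distInt θ)) * ENNReal.ofReal (1 + 2 / (N / 2)) := by
        rw [ENNReal.tsum_mul_left]
        gcongr
        exact sum_int_Wt (by positivity)
    _ = _ := by
        rw [← ENNReal.ofReal_mul (Wt_nonneg _)]
        congr 3
        field_simp
        norm_num

/-- The character `e(t)`. -/
noncomputable def ee (t : ℝ) : ℂ := Complex.exp (2 * Real.pi * Complex.I * t)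

lemma ee_add (s t : ℝ) : ee (s + t) = ee s * ee t := by
  unfold ee
  rw [← Complex.exp_add]
  congr 1
  push_cast
  ring

lemma ee_zero : ee 0 = 1 := by simp [ee]

lemma norm_ee (t : ℝ) : ‖ee t‖ = 1 := by
  unfold ee
  have : (2 * Real.pi * Complex.I * t : ℂ) = ((2 * Real.pi * t : ℝ) : ℂ) * Complex.I := by
    push_cast; ring
  rw [this, Complex.norm_exp_ofReal_mul_I]

lemma ee_sum {ι : Type*} (s : Finset ι) (f : ι → ℝ) : ee (∑ i ∈ s, f i) = ∏ i ∈ s, ee (f i) := by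
  classical
  induction s using Finset.induction_on with
  | empty => simp [ee_zero]
  | insert a s ha ih => rw [Finset.sum_insert ha, Finset.prod_insert ha, ee_add, ih]

lemma poisson {f : ℝ → ℝ} (hc : Continuous f) (hs : Function.support f ⊆ Set.Icc (-2 : ℝ) 2)
    {B : ℝ} (hB : ∀ ξ, ‖fhat f ξ‖ ≤ B * (1 / (1 + |ξ|) ^ 4)) {r : ℝ} (hr : 0 < r) (θ x : ℝ) :
    ∑' n : ℤ, (f ((x + n) / r) : ℂ) * ee (θ * (x + n))
      = ∑' m : ℤ, r * fhat f (r * (m - θ)) * ee (m * x) := by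
  let G : ℝ → ℂ := fun y => (f (y / r) : ℂ) * ee (θ * y)
  have hGc : Continuous G := by
    unfold G ee
    fun_prop
  have hFG : ∀ ξ : ℝ, 𝓕 G ξ = r * fhat f (r * (ξ - θ)) := by
    intro ξ
    rw [Real.fourier_real_eq_integral_exp_smul]
    have e : ∀ v : ℝ, Complex.exp (↑(-2 * Real.pi * v * ξ) * Complex.I) • G v
        = (fun u : ℝ => (f u : ℂ) *
          Complex.exp (-(2 * Real.pi * Complex.I * ((r * (ξ - θ) : ℝ) : ℂ) * u))) (v / r) := by
      intro v
      simp only [G, ee, smul_eq_mul]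
      rw [mul_comm, mul_assoc, ← Complex.exp_add]
      congr 2
      push_cast
      have : (r : ℂ) ≠ 0 := by exact_mod_cast hr.ne'
      field_simp
      ring
    simp only [e]
    rw [MeasureTheory.Measure.integral_comp_div
      (fun u : ℝ => (f u : ℂ) *
          Complex.exp (-(2 * Real.pi * Complex.I * ((r * (ξ - θ) : ℝ) : ℂ) * u))) r]
    rw [abs_of_pos hr]
    rfl
  have hO : G =O[Filter.cocompact ℝ] (fun y : ℝ => |y| ^ (-2 : ℝ)) := by
    have h0 : G =ᶠ[Filter.cocompact ℝ] 0 := by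
      have : (Set.Icc (-(2 * r)) (2 * r))ᶜ ∈ Filter.cocompact ℝ :=
        (isCompact_Icc).compl_mem_cocompact
      filter_upwards [this] with y hy
      have hz : f (y / r) = 0 := by
        by_contra hne
        have := hs (Function.mem_support.2 hne)
        rw [Set.mem_Icc, le_div_iff₀ hr, div_le_iff₀ hr] at this
        exact hy ⟨by linarith [this.1], this.2⟩
      simp [G, hz]
    exact h0.trans_isBigO (Asymptotics.isBigO_zero _ _)
  have hsum : Summable fun n : ℤ => 𝓕 G n := by
    apply Summable.of_norm_bounded (((decay_sum hr θ).1.mul_left (r * B)))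
    intro n
    rw [hFG, norm_mul, Complex.norm_real, Real.norm_eq_abs, abs_of_pos hr, mul_assoc]
    gcongr
    exact hB _
  have := Real.tsum_eq_tsum_fourier_of_rpow_decay_of_summable hGc one_lt_two hO hsum x
  have e1 : ∀ n : ℤ, (f ((x + n) / r) : ℂ) * ee (θ * (x + n)) = G (x + n) := fun n => rfl
  simp only [e1]
  rw [this]
  refine tsum_congr fun m => ?_
  rw [hFG, fourier_coe_apply]
  congr 1
  unfold ee
  congr 1
  push_cast
  field_simp

end Part5

section Part6
open scoped BigOperators ENNReal FourierTransform ContDiff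

lemma fin_supp1 {f : ℝ → ℝ} (hs : Function.support f ⊆ Set.Icc (-2 : ℝ) 2) {r : ℝ} (hr : 0 < r)
    (x : ℝ) : ∃ F : Finset ℤ, ∀ n : ℤ, n ∉ F → f ((x + n) / r) = 0 := by
  refine ⟨Finset.Icc ⌈-(2 * r) - x⌉ ⌊2 * r - x⌋, fun n hn => ?_⟩
  by_contra hne
  have := hs (Function.mem_support.2 hne)
  rw [Set.mem_Icc, le_div_iff₀ hr, div_le_iff₀ hr] at this
  apply hn
  rw [Finset.mem_Icc, Int.ceil_le, Int.le_floor]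
  constructor <;> linarith [this.1, this.2]

/-- The exponential sum weighted by `f`. -/
noncomputable def Esum (f : ℝ → ℝ) (N θ : ℝ) : ℂ := ∑' n : ℤ, (f (n / N) : ℂ) * ee (θ * n)

lemma Esum_eq {f : ℝ → ℝ} (hc : Continuous f) (hs : Function.support f ⊆ Set.Icc (-2 : ℝ) 2)
    {B : ℝ} (hB : ∀ ξ, ‖fhat f ξ‖ ≤ B * (1 / (1 + |ξ|) ^ 4)) {N : ℝ} (hN : 0 < N) (θ : ℝ) :
    Esum f N θ = ∑' m : ℤ, N * fhat f (N * (m - θ)) := by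
  have := poisson hc hs hB hN θ 0
  simpa [ee_zero, Esum] using this

lemma Esum_term {f : ℝ → ℝ} 
    {B : ℝ} (hB : ∀ ξ, ‖fhat f ξ‖ ≤ B * (1 / (1 + |ξ|) ^ 4)) {N : ℝ} (hN : 0 < N) (θ : ℝ) (m : ℤ) :
    ‖(N : ℂ) * fhat f (N * (m - θ))‖ ≤ N * B * (1 / (1 + |N * (m - θ)|) ^ 4) := by
  rw [norm_mul, Complex.norm_real, Real.norm_eq_abs, abs_of_pos hN, mul_assoc]
  gcongr
  exact hB _

lemma Esum_norm {f : ℝ → ℝ} (hc : Continuous f) (hs : Function.support f ⊆ Set.Icc (-2 : ℝ) 2)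
    {B : ℝ} (hB0 : 0 < B) (hB : ∀ ξ, ‖fhat f ξ‖ ≤ B * (1 / (1 + |ξ|) ^ 4)) {N : ℝ} (hN : 1 ≤ N)
    (θ : ℝ) : ‖Esum f N θ‖ ≤ 5 * B * N * Wt (N * distInt θ) := by
  have hN0 : 0 < N := by linarith
  obtain ⟨h1, h2⟩ := decay_sum hN0 θ
  rw [Esum_eq hc hs hB hN0]
  refine (tsum_of_norm_bounded ((h1.mul_left (N * B)).hasSum) (Esum_term hB hN0 θ)).trans ?_
  rw [tsum_mul_left]
  have h4 : 4 / N ≤ 4 := div_le_self (by norm_num) hN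
  calc _ ≤ N * B * (Wt (N * distInt θ) * (1 + 4 / N)) := by gcongr
    _ ≤ N * B * (Wt (N * distInt θ) * (1 + 4)) := by
      have := Wt_nonneg (N * distInt θ)
      gcongr
    _ = _ := by ring

lemma Esum_zero {f : ℝ → ℝ} (hc : Continuous f) (hs : Function.support f ⊆ Set.Icc (-2 : ℝ) 2)
    {B : ℝ} (hB0 : 0 < B) (hB : ∀ ξ, ‖fhat f ξ‖ ≤ B * (1 / (1 + |ξ|) ^ 4)) {N : ℝ} (hN : 1 ≤ N) :
    ‖Esum f N 0 - N * fhat f 0‖ ≤ 2 * B := by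
  have hN0 : 0 < N := by linarith
  have h1 := (decay_sum hN0 0).1
  have hS : Summable fun m : ℤ => (N : ℂ) * fhat f (N * (m - 0)) :=
    Summable.of_norm_bounded (h1.mul_left (N * B)) (Esum_term hB hN0 0)
  rw [Esum_eq hc hs hB hN0, hS.tsum_eq_add_tsum_ite 0]
  simp only [Int.cast_zero, sub_zero, mul_zero, add_sub_cancel_left]
  have h0 : ∀ k : ℤ, 0 ≤ (if k = 0 then 0 else Wt (N * |(k : ℝ)|)) := by
    intro k; split_ifs
    · exact le_rfl
    · exact Wt_nonneg _
  have hq := summable_of_ofReal (g := fun k : ℤ => if k = 0 then 0 else Wt (N * |(k : ℝ)|))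
    (K := 2 / N) h0 (by positivity) (by
      refine le_trans (le_of_eq ?_) (sum_int_Wt0 hN0)
      refine tsum_congr fun k => ?_
      split_ifs <;> simp)
  refine (tsum_of_norm_bounded ((hq.1.mul_left (N * B)).hasSum) ?_).trans ?_
  · intro k
    by_cases hk : k = 0
    · simp [hk]
    · simp only [hk, if_false]
      have := Esum_term hB hN0 0 k
      rw [sub_zero] at this
      refine this.trans ?_
      gcongr
      unfold Wt
      rw [abs_mul, abs_of_pos hN0]
      apply one_div_le_one_div_of_le (by positivity)
      apply pow_le_pow_right₀ _ (by norm_num)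
      have : 0 ≤ N * |(k : ℝ)| := by positivity
      linarith
  · rw [tsum_mul_left]
    calc _ ≤ N * B * (2 / N) := by gcongr; exact hq.2
      _ = 2 * B := by field_simp

/-- The dual coefficient. -/
noncomputable def coef {d : ℕ} (f : ℝ → ℝ) (γ ρ : Fin d → ℝ) (m : Fin d → ℤ) : ℂ :=
  ∏ i, ((ρ i : ℂ) * fhat f (ρ i * m i) * ee (-(m i * γ i)))

lemma kron_inner_sum {d : ℕ} {f : ℝ → ℝ} (hc : Continuous f)
    (hs : Function.support f ⊆ Set.Icc (-2 : ℝ) 2)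
    {B : ℝ} (hB : ∀ ξ, ‖fhat f ξ‖ ≤ B * (1 / (1 + |ξ|) ^ 4))
    (α γ ρ : Fin d → ℝ) (hρ : ∀ i, 0 < ρ i) (n : ℤ) :
    (Summable fun m : Fin d → ℤ => coef f γ ρ m * ee ((∑ i, m i * α i) * n)) ∧
    ∑' a : Fin d → ℤ, ∏ i, (f (((a i : ℝ) + n * α i - γ i) / ρ i) : ℂ)
      = ∑' m : Fin d → ℤ, coef f γ ρ m * ee ((∑ i, m i * α i) * n) := by
  have hL := (complex_tsum_pi_prod
    (fun (i : Fin d) (a : ℤ) => (f (((a : ℝ) + n * α i - γ i) / ρ i) : ℂ)) (by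
      intro i
      obtain ⟨F, hF⟩ := fin_supp1 hs (hρ i) (n * α i - γ i)
      apply summable_of_ne_finset_zero (s := F)
      intro a ha
      have := hF a ha
      rw [show (a : ℝ) + n * α i - γ i = n * α i - γ i + a by ring, this]
      simp)).2
  have hR := complex_tsum_pi_prod
    (fun (i : Fin d) (m : ℤ) =>
      (ρ i : ℂ) * fhat f (ρ i * (m - 0)) * ee (m * (n * α i - γ i))) (by
      intro i
      apply Summable.of_nonneg_of_le (fun _ => norm_nonneg _) _
        ((decay_sum (hρ i) 0).1.mul_left (ρ i * B))
      intro m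
      rw [norm_mul, norm_ee, mul_one]
      exact Esum_term hB (hρ i) 0 m)
  have hprod : ∀ m : Fin d → ℤ, coef f γ ρ m * ee ((∑ i, m i * α i) * n)
      = ∏ i, ((ρ i : ℂ) * fhat f (ρ i * ((m i : ℝ) - 0)) * ee (m i * (n * α i - γ i))) := by
    intro m
    unfold coef
    rw [Finset.sum_mul, ee_sum, ← Finset.prod_mul_distrib]
    refine Finset.prod_congr rfl fun i _ => ?_
    rw [sub_zero, mul_assoc _ (ee _) (ee _), ← ee_add]
    congr 2
    ring
  simp only [hprod]
  refine ⟨hR.1.of_norm, ?_⟩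
  rw [hL, hR.2]
  refine Finset.prod_congr rfl fun i _ => ?_
  rw [← poisson hc hs hB (hρ i) 0 (n * α i - γ i)]
  refine tsum_congr fun a => ?_
  rw [zero_mul, ee_zero, mul_one]
  congr 3
  ring

lemma full_sum {d : ℕ} {f : ℝ → ℝ} (hc : Continuous f)
    (hg : GoodWeights (d + 1) 3 (fun _ => f))
    (hs : Function.support f ⊆ Set.Icc (-2 : ℝ) 2)
    {B : ℝ} (hB : ∀ ξ, ‖fhat f ξ‖ ≤ B * (1 / (1 + |ξ|) ^ 4))
    (α γ ρ : Fin d → ℝ) (hρ : ∀ i, 0 < ρ i) (N : ℝ) (hN : 0 < N) :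
    (Summable fun m : Fin d → ℤ => coef f γ ρ m * Esum f N (∑ i, m i * α i)) ∧
    ((∑' p, boxTerm d (fun _ => f) α γ ρ N p : ℝ) : ℂ)
      = ∑' m : Fin d → ℤ, coef f γ ρ m * Esum f N (∑ i, m i * α i) := by
  obtain ⟨F, hF⟩ := fin_supp1 hs hN 0
  simp only [zero_add] at hF
  have hE : ∀ θ, Esum f N θ = ∑ n ∈ F, (f (n / N) : ℂ) * ee (θ * n) := by
    intro θ
    apply tsum_eq_sum
    intro n hn
    rw [hF n hn]; simp
  have hT : ∀ m : Fin d → ℤ, coef f γ ρ m * Esum f N (∑ i, m i * α i)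
      = ∑ n ∈ F, (f (n / N) : ℂ) * (coef f γ ρ m * ee ((∑ i, m i * α i) * n)) := by
    intro m
    rw [hE, Finset.mul_sum]
    refine Finset.sum_congr rfl fun n _ => ?_
    ring
  have hI := fun n : ℤ => kron_inner_sum hc hs hB α γ ρ hρ n
  have hSm : ∀ n ∈ F, Summable fun m : Fin d → ℤ =>
      (f (n / N) : ℂ) * (coef f γ ρ m * ee ((∑ i, m i * α i) * n)) :=
    fun n _ => (hI n).1.mul_left _
  simp only [hT]
  refine ⟨summable_sum hSm, ?_⟩
  rw [Summable.tsum_finsetSum hSm]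
  rw [Complex.ofReal_tsum, ← (Equiv.prodComm ℤ (Fin d → ℤ)).tsum_eq]
  have hfin := boxTerm_finite hg α γ ρ hρ N hN
  have hsum : Summable fun p : ℤ × (Fin d → ℤ) =>
      ((boxTerm d (fun _ => f) α γ ρ N (Equiv.prodComm ℤ (Fin d → ℤ) p) : ℝ) : ℂ) := by
    have h1 : Summable fun p => ((boxTerm d (fun _ => f) α γ ρ N p : ℝ) : ℂ) := by
      apply summable_of_ne_finset_zero (s := hfin.toFinset)
      intro p hp
      have : boxTerm d (fun _ => f) α γ ρ N p = 0 := by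
        by_contra h
        exact hp (by simpa using h)
      rw [this]; simp
    exact (Equiv.prodComm ℤ (Fin d → ℤ)).summable_iff.2 h1
  rw [hsum.tsum_prod]
  have hinner : ∀ n : ℤ, ∑' a : Fin d → ℤ,
      ((boxTerm d (fun _ => f) α γ ρ N (Equiv.prodComm ℤ (Fin d → ℤ) (n, a)) : ℝ) : ℂ)
      = (f (n / N) : ℂ) * ∑' m : Fin d → ℤ, coef f γ ρ m * ee ((∑ i, m i * α i) * n) := by
    intro n
    rw [← (hI n).2, ← tsum_mul_left]
    refine tsum_congr fun a => ?_
    simp [boxTerm]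
  simp only [hinner]
  rw [tsum_eq_sum (s := F)]
  · refine Finset.sum_congr rfl fun n _ => ?_
    rw [tsum_mul_left]
  · intro n hn
    rw [hF n hn]; simp

lemma coef_norm {d : ℕ} {f : ℝ → ℝ} {B : ℝ} (hB0 : 0 < B)
    (hB : ∀ ξ, ‖fhat f ξ‖ ≤ B * (1 / (1 + |ξ|) ^ 4))
    (γ ρ : Fin d → ℝ) (hρ : ∀ i, 0 < ρ i) (m : Fin d → ℤ) :
    ‖coef f γ ρ m‖ ≤ ∏ i, (ρ i * B * Wt (ρ i * |(m i : ℝ)|)) := by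
  unfold coef
  rw [norm_prod]
  refine Finset.prod_le_prod (fun _ _ => norm_nonneg _) fun i _ => ?_
  rw [norm_mul, norm_ee, mul_one]
  have h := Esum_term hB (hρ i) 0 (m i)
  rw [sub_zero] at h
  refine h.trans ?_
  have := hρ i
  gcongr
  unfold Wt
  rw [abs_mul, abs_of_pos this]
  apply one_div_le_one_div_of_le (by positivity)
  apply pow_le_pow_right₀ _ (by norm_num)
  have : 0 ≤ ρ i * |(m i : ℝ)| := by positivity
  linarith

lemma bounded_of_dual {d : ℕ} {f : ℝ → ℝ} (hc : Continuous f)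
    (hg : GoodWeights (d + 1) 3 (fun _ => f))
    (hs : Function.support f ⊆ Set.Icc (-2 : ℝ) 2)
    (him : (fhat f 0).im = 0)
    {B : ℝ} (hB0 : 0 < B) (hB : ∀ ξ, ‖fhat f ξ‖ ≤ B * (1 / (1 + |ξ|) ^ 4))
    (α : Fin d → ℝ) (ε : ℝ) (hε : 0 < ε)
    (hα : ∀ m : Fin d → ℤ, m ≠ 0 →
      ε ≤ (∏ i, max 1 |(m i : ℝ)|) * distInt (∑ i, m i * α i))
    (γ ρ : Fin d → ℝ) (hρ : IsBox ρ) (N : ℝ) (hN : 1 ≤ N) :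
    |Dbox d (fun _ => f) α γ ρ N| ≤ B ^ d * (2 * B) + 40 * B ^ (d + 1) * 3 ^ d / ε := by
  have hN0 : 0 < N := by linarith
  have hρ0 : ∀ i, 0 < ρ i := fun i => (hρ i).1
  obtain ⟨hS, hE⟩ := full_sum hc hg hs hB α γ ρ hρ0 N hN0
  have hre : fhat f 0 = (((fhat f 0).re : ℝ) : ℂ) := by
    apply Complex.ext <;> simp [him]
  have hD : ((Dbox d (fun _ => f) α γ ρ N : ℝ) : ℂ)
      = (∏ i, ((ρ i : ℂ) * fhat f 0)) * (Esum f N 0 - N * fhat f 0)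
        + ∑' m : Fin d → ℤ, if m = 0 then 0 else coef f γ ρ m * Esum f N (∑ i, m i * α i) := by
    have h1 : Dbox d (fun _ => f) α γ ρ N = (∑' p, boxTerm d (fun _ => f) α γ ρ N p)
      - smoothC (fun _ : Fin (d + 1) => f) * ((∏ i, ρ i) * N) := rfl
    rw [h1, Complex.ofReal_sub, hE, hS.tsum_eq_add_tsum_ite 0]
    have h2 : coef f γ ρ 0 = ∏ i, ((ρ i : ℂ) * fhat f 0) := by
      simp [coef, ee_zero]
    have h3 : (∑ i, (((0 : Fin d → ℤ) i : ℤ) : ℝ) * α i) = 0 := by simp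
    rw [h2, h3]
    have h4 : ((smoothC (fun _ : Fin (d + 1) => f) * ((∏ i, ρ i) * N) : ℝ) : ℂ)
        = (∏ i, ((ρ i : ℂ) * fhat f 0)) * (N * fhat f 0) := by
      unfold smoothC
      push_cast
      rw [← hre]
      simp only [Finset.prod_const, Finset.prod_mul_distrib, Finset.card_univ, Fintype.card_fin]
      ring
    rw [h4]
    ring
  rw [← Real.norm_eq_abs, ← Complex.norm_real, hD]
  refine (norm_add_le _ _).trans (add_le_add ?_ ?_)
  · rw [norm_mul]
    refine mul_le_mul ?_ (Esum_zero hc hs hB0 hB hN) (norm_nonneg _) (by positivity)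
    rw [norm_prod]
    calc _ ≤ ∏ _i : Fin d, B := by
          refine Finset.prod_le_prod (fun _ _ => norm_nonneg _) fun i _ => ?_
          have h := hB 0
          simp only [abs_zero, add_zero, one_pow, div_one, mul_one] at h
          rw [norm_mul, Complex.norm_real, Real.norm_eq_abs, abs_of_pos (hρ0 i)]
          have := (hρ i).2
          have := hρ0 i
          nlinarith [norm_nonneg (fhat f 0)]
      _ = B ^ d := by simp
  · have hK : 0 ≤ 40 * B ^ (d + 1) * 3 ^ d / ε := by positivity
    rw [← ENNReal.ofReal_le_ofReal_iff hK, ofReal_norm]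
    refine enorm_tsum_le_tsum_enorm.trans ?_
    have hterm : ∀ m : Fin d → ℤ,
        ‖(if m = 0 then 0 else coef f γ ρ m * Esum f N (∑ i, m i * α i))‖ₑ
        ≤ ENNReal.ofReal ((∏ i, (ρ i * B)) * (5 * B * N)) *
          (if m ≠ 0 then (∏ i, ENNReal.ofReal (Wt (ρ i * |(m i : ℝ)|))) *
            ENNReal.ofReal (Wt (N * distInt (∑ i, m i * α i))) else 0) := by
      intro m
      by_cases hm : m = 0
      · simp [hm]
      · simp only [hm, if_false, ne_eq, not_false_eq_true, if_true]
        have hP : 0 ≤ ∏ i, (ρ i * B) := Finset.prod_nonneg fun i _ => by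
          have := hρ0 i; positivity
        have hP2 : 0 ≤ ∏ i, Wt (ρ i * |(m i : ℝ)|) := Finset.prod_nonneg fun i _ => Wt_nonneg _
        rw [← ofReal_norm, ← ENNReal.ofReal_prod_of_nonneg (fun i _ => Wt_nonneg _),
          ← ENNReal.ofReal_mul hP2, ← ENNReal.ofReal_mul (by positivity)]
        apply ENNReal.ofReal_le_ofReal
        rw [norm_mul]
        calc _ ≤ (∏ i, (ρ i * B * Wt (ρ i * |(m i : ℝ)|))) *
              (5 * B * N * Wt (N * distInt (∑ i, m i * α i))) := by
              refine mul_le_mul (coef_norm hB0 hB γ ρ hρ0 m) (Esum_norm hc hs hB0 hB hN _)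
                (norm_nonneg _) ?_
              rw [Finset.prod_mul_distrib]
              positivity
          _ = _ := by rw [Finset.prod_mul_distrib]; ring
    refine (ENNReal.tsum_le_tsum hterm).trans ?_
    rw [ENNReal.tsum_mul_left]
    refine (mul_le_mul_right (main_sum α ε hε hα ρ hρ0 N hN0) _).trans ?_
    have hP : 0 ≤ ∏ i, (ρ i * B) := Finset.prod_nonneg fun i _ => by
      have := hρ0 i; positivity
    rw [← ENNReal.ofReal_prod_of_nonneg (fun i _ => by have := hρ0 i; positivity),
      ← ENNReal.ofReal_mul (by positivity), ← ENNReal.ofReal_mul (by positivity)]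
    apply ENNReal.ofReal_le_ofReal
    have hfac : (∏ i, (ρ i * B)) * ∏ i, (1 + 2 / ρ i) ≤ B ^ d * 3 ^ d := by
      rw [← Finset.prod_mul_distrib]
      calc _ ≤ ∏ _i : Fin d, (B * 3) := by
            refine Finset.prod_le_prod (fun i _ => by have := hρ0 i; positivity) fun i _ => ?_
            have h1 := hρ0 i
            have h2 := (hρ i).2
            have : ρ i * B * (1 + 2 / ρ i) = B * (ρ i + 2) := by field_simp
            rw [this]
            gcongr
            linarith
        _ = _ := by simp [mul_pow]
    calc _ = ((∏ i, (ρ i * B)) * ∏ i, (1 + 2 / ρ i)) * (40 * B / ε) := by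
          generalize (∏ i, (ρ i * B)) = P
          generalize (∏ i, (1 + 2 / ρ i)) = Q
          field_simp
          ring
      _ ≤ (B ^ d * 3 ^ d) * (40 * B / ε) := by gcongr
      _ = _ := by ring

end Part6

/-- Theorem: Littlewood's conjecture in d dimensions is equivalent to
unboundedness of the C³-smooth discrepancy of every d-dimensional Kronecker sequence. -/
theorem littlewood_iff_smooth_discrepancy_unbounded (d : ℕ) (hd : 2 ≤ d) :
    (∀ α : Fin d → ℝ,
        Filter.liminf (fun n : ℕ => (n : ℝ) * ∏ i, distInt ((n : ℝ) * α i))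
          Filter.atTop = 0)
    ↔
    (∀ α : Fin d → ℝ, ∀ w : Fin (d+1) → ℝ → ℝ, GoodWeights (d+1) 3 w →
        ∀ C : ℝ, 0 < C → ∃ N : ℕ, 1 ≤ N ∧
          ∃ γ ρ : Fin d → ℝ, IsBox ρ ∧ C < |Dbox d w α γ ρ N|) := by
  constructor
  · intro hL α w hw C _
    exact unbounded_of_littlewood α ((liminf_lwu_iff hd α).1 (hL α)) w hw C
  · intro hU α
    refine (liminf_lwu_iff hd α).2 ?_
    by_contra hcon
    push Not at hcon
    obtain ⟨c, hc, h⟩ := hcon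
    obtain ⟨ε, hε, hdual⟩ := transference hd α c hc h
    obtain ⟨f, hf0, hfs, hfc, hfh, hfp, B, hB0, hB⟩ := exists_weight
    have hg : GoodWeights (d + 1) 3 (fun _ => f) := fun _ => ⟨hf0, hfs, by exact_mod_cast hfc, hfh, hfp⟩
    obtain ⟨N, hN, γ, ρ, hρ, hlt⟩ := hU α (fun _ => f) hg
      (B ^ d * (2 * B) + 40 * B ^ (d + 1) * 3 ^ d / ε) (by positivity)
    exact absurd (bounded_of_dual hfc.continuous hg hfs (hfh 0).1 hB0 hB α ε hε hdual γ ρ hρ N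
      (by exact_mod_cast hN)) (not_le.2 hlt)
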